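/- arXiv:1703.09372 — 9 statements merged into one kernel-verified Lean document; each statement's English description precedes it below -/
import Mathlib

section
/- Let H ∈ (0,1), θ > 0 and set β = θ^{-2H} H Γ(2H). Define for t > 0: G₁(t) = (1/2) e^{-θt} θ² ∫_{-∞}^0 ∫_0^t (|s|^{2H} + u^{2H} - (u-s)^{2H}) e^{θ(u+s)} du ds, G₂(t) = (1/2) θ ∫_{-∞}^0 (|s|^{2H} + t^{2H} - (t-s)^{2H}) e^{θs} ds, and C(t) = e^{-θt} β + G₁(t) - G₂(t). Then lim_{t → 0⁺} t^{-2H} ( C(t) - β (1 - θ^{2H} t^{2H} / Γ(2H+1)) ) = 0; that is, C(t) = β (1 - θ^{2H} t^{2H} / Γ(2H+1) + o(t^{2H})) as t → 0⁺. -/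
open MeasureTheory

/-- The density `v ^ a * exp (-θ v)` of a (non-normalized) Gamma law is continuous for `0 ≤ a`. -/
lemma continuous_rpow_mul_exp_neg {a : ℝ} (ha : 0 ≤ a) (θ : ℝ) :
    Continuous fun v : ℝ => v ^ a * Real.exp (-(θ * v)) :=
  (continuous_id.rpow_const fun _ => Or.inr ha).mul (by fun_prop)

lemma integrableOn_rpow_mul_exp_neg {a θ : ℝ} (ha : 0 < a) (hθ : 0 < θ) :
    IntegrableOn (fun v : ℝ => v ^ a * Real.exp (-(θ * v))) (Set.Ioi 0) := by
  have h := integrableOn_rpow_mul_exp_neg_mul_rpow (p := 1) (s := a) (b := θ)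
    (by linarith) one_pos hθ
  simpa [neg_mul] using h

lemma integral_rpow_mul_exp_neg {a θ : ℝ} (ha : 0 < a) (hθ : 0 < θ) :
    ∫ v in Set.Ioi (0 : ℝ), v ^ a * Real.exp (-(θ * v)) = θ ^ (-a) * (a * Real.Gamma a) / θ := by
  have h := Real.integral_rpow_mul_exp_neg_mul_Ioi (a := a + 1) (r := θ) (by linarith) hθ
  rw [add_sub_cancel_right, Real.Gamma_add_one ha.ne', one_div, Real.inv_rpow hθ.le,
    ← Real.rpow_neg hθ.le, neg_add, Real.rpow_add hθ, Real.rpow_neg_one] at h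
  rw [h]
  ring

lemma integrableOn_sub_rpow_mul_exp {a θ u : ℝ} (ha : 0 < a) (hθ : 0 < θ) (hu : 0 ≤ u) :
    IntegrableOn (fun s : ℝ => (u - s) ^ a * Real.exp (θ * s)) (Set.Iio 0) := by
  have hpre : (fun s : ℝ => u - s) ⁻¹' Set.Ioi u = Set.Iio 0 := by ext; simp
  have h := ((Measure.measurePreserving_sub_left volume u).integrableOn_comp_preimage
    (MeasurableEquiv.subLeft u).measurableEmbedding).2
    ((integrableOn_rpow_mul_exp_neg ha hθ).mono_set (Set.Ioi_subset_Ioi hu))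
  rw [hpre] at h
  refine (h.const_mul (Real.exp (θ * u))).congr (Filter.Eventually.of_forall fun s => ?_)
  simp only [Function.comp]
  rw [mul_left_comm, ← Real.exp_add]
  ring_nf

/-- Reflection `s ↦ u - s` turns an exponentially weighted integral over the negative half-line
into a tail of the Gamma integral. -/
lemma integral_sub_rpow_mul_exp {a θ u : ℝ} (ha : 0 < a) (hθ : 0 < θ) (hu : 0 ≤ u) :
    ∫ s in Set.Iio (0 : ℝ), (u - s) ^ a * Real.exp (θ * s) =
      Real.exp (θ * u) * ((∫ v in Set.Ioi (0 : ℝ), v ^ a * Real.exp (-(θ * v))) -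
        ∫ v in (0 : ℝ)..u, v ^ a * Real.exp (-(θ * v))) := by
  have hpre : (fun s : ℝ => u - s) ⁻¹' Set.Ioi u = Set.Iio 0 := by ext; simp
  have h := (Measure.measurePreserving_sub_left volume u).setIntegral_preimage_emb
    (MeasurableEquiv.subLeft u).measurableEmbedding
    (fun v : ℝ => v ^ a * Real.exp (-(θ * v))) (Set.Ioi u)
  rw [hpre] at h
  have hint := integrableOn_rpow_mul_exp_neg ha hθ
  have h2 := intervalIntegral.integral_interval_add_Ioi hint
    (hint.mono_set (Set.Ioi_subset_Ioi hu))
  rw [← h2, add_sub_cancel_left, ← h, ← integral_const_mul]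
  congr 1
  ext s
  rw [mul_left_comm, ← Real.exp_add]
  ring_nf

lemma integral_exp_mul_Iio {θ : ℝ} (hθ : 0 < θ) :
    ∫ s in Set.Iio (0 : ℝ), Real.exp (θ * s) = 1 / θ := by
  rw [← integral_Iic_eq_integral_Iio, integral_exp_mul_Iic hθ]
  simp

lemma integrableOn_exp_mul_Iio {θ : ℝ} (hθ : 0 < θ) :
    IntegrableOn (fun s : ℝ => Real.exp (θ * s)) (Set.Iio 0) :=
  (integrableOn_exp_mul_Iic hθ 0).mono_set Set.Iio_subset_Iic_self

lemma integrableOn_abs_rpow_mul_exp {a θ : ℝ} (ha : 0 < a) (hθ : 0 < θ) :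
    IntegrableOn (fun s : ℝ => |s| ^ a * Real.exp (θ * s)) (Set.Iio 0) := by
  refine (integrableOn_sub_rpow_mul_exp ha hθ le_rfl).congr_fun (fun s hs => ?_) measurableSet_Iio
  rw [Set.mem_Iio] at hs
  simp only [abs_of_neg hs, zero_sub]

lemma integral_abs_rpow_mul_exp {a θ : ℝ} (ha : 0 < a) (hθ : 0 < θ) :
    ∫ s in Set.Iio (0 : ℝ), |s| ^ a * Real.exp (θ * s) =
      ∫ v in Set.Ioi (0 : ℝ), v ^ a * Real.exp (-(θ * v)) := by
  have h := integral_sub_rpow_mul_exp ha hθ le_rfl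
  rw [mul_zero, Real.exp_zero, one_mul, intervalIntegral.integral_same, sub_zero] at h
  rw [← h]
  refine setIntegral_congr_fun measurableSet_Iio fun s hs => ?_
  rw [Set.mem_Iio] at hs
  simp only [abs_of_neg hs, zero_sub]

/-- The single integral of the fractional Brownian covariance against the exponential weight. -/
lemma integral_fbm_covariance_mul_exp {a θ u : ℝ} (ha : 0 < a) (hθ : 0 < θ) (hu : 0 ≤ u) :
    ∫ s in Set.Iio (0 : ℝ), (|s| ^ a + u ^ a - (u - s) ^ a) * Real.exp (θ * s) =
      (∫ v in Set.Ioi (0 : ℝ), v ^ a * Real.exp (-(θ * v))) + u ^ a / θ -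
      Real.exp (θ * u) * ((∫ v in Set.Ioi (0 : ℝ), v ^ a * Real.exp (-(θ * v))) -
        ∫ v in (0 : ℝ)..u, v ^ a * Real.exp (-(θ * v))) := by
  simp only [sub_mul, add_mul]
  have h1 := integrableOn_abs_rpow_mul_exp ha hθ
  have h2 := (integrableOn_exp_mul_Iio hθ).const_mul (u ^ a)
  have h12 : Integrable (fun s : ℝ => |s| ^ a * Real.exp (θ * s) + u ^ a * Real.exp (θ * s))
      (volume.restrict (Set.Iio 0)) := h1.add h2
  rw [integral_sub h12 (integrableOn_sub_rpow_mul_exp ha hθ hu), integral_add h1 h2,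
    integral_const_mul, integral_exp_mul_Iio hθ, integral_abs_rpow_mul_exp ha hθ,
    integral_sub_rpow_mul_exp ha hθ hu, mul_one_div]

lemma integrable_prod_fbm_covariance_mul_exp {a θ t : ℝ} (ha : 0 < a) (hθ : 0 < θ) (ht : 0 ≤ t) :
    Integrable (Function.uncurry fun s u : ℝ =>
        (|s| ^ a + u ^ a - (u - s) ^ a) * Real.exp (θ * (u + s)))
      ((volume.restrict (Set.Iio 0)).prod (volume.restrict (Set.Ioc 0 t))) := by
  have hs : Integrable (fun s : ℝ => |s| ^ a * Real.exp (θ * s) + t ^ a * Real.exp (θ * s) +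
      (t - s) ^ a * Real.exp (θ * s)) (volume.restrict (Set.Iio 0)) :=
    ((integrableOn_abs_rpow_mul_exp ha hθ).add
      ((integrableOn_exp_mul_Iio hθ).const_mul (t ^ a))).add
      (integrableOn_sub_rpow_mul_exp ha hθ ht)
  have hdom := hs.mul_prod (integrable_const (μ := volume.restrict (Set.Ioc 0 t))
    (Real.exp (θ * t)))
  refine hdom.mono' ?_ ?_
  · have hc : Continuous (Function.uncurry fun s u : ℝ =>
        (|s| ^ a + u ^ a - (u - s) ^ a) * Real.exp (θ * (u + s))) := by
      have h1 : Continuous fun p : ℝ × ℝ => |p.1| ^ a :=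
        (continuous_abs.comp continuous_fst).rpow_const fun _ => Or.inr ha.le
      have h2 : Continuous fun p : ℝ × ℝ => p.2 ^ a :=
        continuous_snd.rpow_const fun _ => Or.inr ha.le
      have h3 : Continuous fun p : ℝ × ℝ => (p.2 - p.1) ^ a :=
        (continuous_snd.sub continuous_fst).rpow_const fun _ => Or.inr ha.le
      exact ((h1.add h2).sub h3).mul (by fun_prop)
    exact hc.aestronglyMeasurable
  · rw [Measure.prod_restrict]
    filter_upwards [ae_restrict_mem (measurableSet_Iio.prod measurableSet_Ioc)] with p hp
    obtain ⟨h1, h2, h3⟩ := hp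
    rw [Set.mem_Iio] at h1
    have e1 : 0 ≤ |p.1| ^ a := by positivity
    have e2 : 0 ≤ p.2 ^ a := Real.rpow_nonneg h2.le _
    have e3 : 0 ≤ (p.2 - p.1) ^ a := Real.rpow_nonneg (by linarith) _
    have e4 : p.2 ^ a ≤ t ^ a := Real.rpow_le_rpow h2.le h3 ha.le
    have e5 : (p.2 - p.1) ^ a ≤ (t - p.1) ^ a :=
      Real.rpow_le_rpow (by linarith) (by linarith) ha.le
    have e6 : Real.exp (θ * (p.2 + p.1)) ≤ Real.exp (θ * p.1) * Real.exp (θ * t) := by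
      rw [← Real.exp_add, Real.exp_le_exp]
      nlinarith
    simp only [Function.uncurry, norm_mul, Real.norm_eq_abs, Real.abs_exp]
    rw [← add_mul, ← add_mul, mul_assoc]
    refine mul_le_mul ?_ e6 (Real.exp_nonneg _) (by linarith)
    rw [abs_le]
    constructor <;> linarith

lemma integral_integral_fbm_covariance_mul_exp {a θ t : ℝ} (ha : 0 < a) (hθ : 0 < θ)
    (ht : 0 ≤ t) :
    (∫ s in Set.Iio (0 : ℝ), ∫ u in (0 : ℝ)..t,
        (|s| ^ a + u ^ a - (u - s) ^ a) * Real.exp (θ * (u + s))) =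
      ∫ u in (0 : ℝ)..t, Real.exp (θ * u) *
        ∫ s in Set.Iio (0 : ℝ), (|s| ^ a + u ^ a - (u - s) ^ a) * Real.exp (θ * s) := by
  simp only [intervalIntegral.integral_of_le ht]
  rw [integral_integral_swap (integrable_prod_fbm_covariance_mul_exp ha hθ ht)]
  congr 1
  ext u
  rw [← integral_const_mul]
  congr 1
  ext s
  rw [mul_add, Real.exp_add]
  ring

lemma integral_rpow_mul_exp_neg_nonneg {a θ u : ℝ} (hu : 0 ≤ u) :
    0 ≤ ∫ v in (0 : ℝ)..u, v ^ a * Real.exp (-(θ * v)) :=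
  intervalIntegral.integral_nonneg hu fun _ hv =>
    mul_nonneg (Real.rpow_nonneg hv.1 _) (Real.exp_nonneg _)

lemma integral_rpow_mul_exp_neg_le {a θ u : ℝ} (ha : 0 < a) (hθ : 0 < θ) (hu : 0 ≤ u) :
    ∫ v in (0 : ℝ)..u, v ^ a * Real.exp (-(θ * v)) ≤ u ^ a * u := by
  have h := intervalIntegral.norm_integral_le_of_norm_le_const (a := 0) (b := u) (C := u ^ a)
    (f := fun v : ℝ => v ^ a * Real.exp (-(θ * v))) (fun v hv => by
      rw [Set.uIoc_of_le hu] at hv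
      have h1 : 0 ≤ v ^ a := Real.rpow_nonneg hv.1.le _
      rw [norm_mul, Real.norm_eq_abs, Real.norm_eq_abs, Real.abs_exp, abs_of_nonneg h1]
      have h2 : v ^ a ≤ u ^ a := Real.rpow_le_rpow hv.1.le hv.2 ha.le
      have h3 : Real.exp (-(θ * v)) ≤ 1 := by
        rw [Real.exp_le_one_iff]
        nlinarith [hv.1]
      nlinarith [Real.exp_nonneg (-(θ * v))])
  rw [sub_zero, abs_of_nonneg hu] at h
  exact (le_abs_self _).trans h

/-- The double integral is an explicit exponential term up to `O(t ^ (a + 1))`. -/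
lemma abs_integral_integral_fbm_covariance_sub_le {a θ t : ℝ} (ha : 0 < a) (hθ : 0 < θ)
    (ht : 0 ≤ t) (ht1 : t ≤ 1) (hθt : θ * t ≤ 1) :
    |(∫ s in Set.Iio (0 : ℝ), ∫ u in (0 : ℝ)..t,
        (|s| ^ a + u ^ a - (u - s) ^ a) * Real.exp (θ * (u + s))) -
      (∫ v in Set.Ioi (0 : ℝ), v ^ a * Real.exp (-(θ * v))) *
        ((Real.exp (θ * t) - 1) / θ - (Real.exp (θ * t) ^ 2 - 1) / (2 * θ))| ≤
      (Real.exp 1 / θ + Real.exp 1 ^ 2) * t ^ a * t := by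
  rw [integral_integral_fbm_covariance_mul_exp ha hθ ht]
  set G := ∫ v in Set.Ioi (0 : ℝ), v ^ a * Real.exp (-(θ * v)) with hG
  set R : ℝ → ℝ := fun u => ∫ v in (0 : ℝ)..u, v ^ a * Real.exp (-(θ * v)) with hR
  have hRc : Continuous R := intervalIntegral.continuous_primitive
    (fun x y => (continuous_rpow_mul_exp_neg ha.le θ).intervalIntegrable x y) 0
  have hpow : Continuous fun u : ℝ => u ^ a := continuous_id.rpow_const fun _ => Or.inr ha.le
  have hsplit : (∫ u in (0 : ℝ)..t, Real.exp (θ * u) *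
        ∫ s in Set.Iio (0 : ℝ), (|s| ^ a + u ^ a - (u - s) ^ a) * Real.exp (θ * s)) =
      (∫ u in (0 : ℝ)..t, G * (Real.exp (θ * u) - Real.exp (2 * θ * u))) +
      ∫ u in (0 : ℝ)..t, (Real.exp (θ * u) * (u ^ a / θ) + Real.exp (θ * u) ^ 2 * R u) := by
    rw [← intervalIntegral.integral_add]
    · refine intervalIntegral.integral_congr fun u hu => ?_
      rw [Set.uIcc_of_le ht] at hu
      rw [integral_fbm_covariance_mul_exp ha hθ hu.1, ← hG]
      have : Real.exp (2 * θ * u) = Real.exp (θ * u) ^ 2 := by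
        rw [← Real.exp_nat_mul]; push_cast; ring_nf
      rw [this]
      simp only [hR]
      ring
    · exact Continuous.intervalIntegrable (by fun_prop) _ _
    · exact Continuous.intervalIntegrable (by fun_prop) _ _
  have hexp : ∀ c : ℝ, 0 < c → ∫ u in (0 : ℝ)..t, Real.exp (c * u) =
      (Real.exp (c * t) - 1) / c := fun c hc => by
    rw [intervalIntegral.integral_comp_mul_left (fun x => Real.exp x) hc.ne', integral_exp,
      mul_zero, Real.exp_zero, smul_eq_mul]
    field_simp
  have hmain : (∫ u in (0 : ℝ)..t, G * (Real.exp (θ * u) - Real.exp (2 * θ * u))) =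
      G * ((Real.exp (θ * t) - 1) / θ - (Real.exp (θ * t) ^ 2 - 1) / (2 * θ)) := by
    rw [intervalIntegral.integral_const_mul, intervalIntegral.integral_sub
      (Continuous.intervalIntegrable (by fun_prop) _ _)
      (Continuous.intervalIntegrable (by fun_prop) _ _), hexp θ hθ, hexp (2 * θ) (by positivity)]
    congr 4
    rw [← Real.exp_nat_mul]; push_cast; ring_nf
  rw [hsplit, hmain, add_sub_cancel_left, ← Real.norm_eq_abs]
  have h := intervalIntegral.norm_integral_le_of_norm_le_const (a := 0) (b := t)
    (C := (Real.exp 1 / θ + Real.exp 1 ^ 2) * t ^ a)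
    (f := fun u : ℝ => Real.exp (θ * u) * (u ^ a / θ) + Real.exp (θ * u) ^ 2 * R u)
    (fun u hu => by
      rw [Set.uIoc_of_le ht] at hu
      have h0 : 0 ≤ u ^ a := Real.rpow_nonneg hu.1.le _
      have h1 : u ^ a ≤ t ^ a := Real.rpow_le_rpow hu.1.le hu.2 ha.le
      have h2 : Real.exp (θ * u) ≤ Real.exp 1 := by
        rw [Real.exp_le_exp]
        nlinarith [hu.2]
      have h3 : 0 ≤ R u := integral_rpow_mul_exp_neg_nonneg hu.1.le
      have h4 : R u ≤ t ^ a :=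
        (integral_rpow_mul_exp_neg_le ha hθ hu.1.le).trans (by nlinarith [hu.1, hu.2])
      rw [Real.norm_of_nonneg (by positivity)]
      calc Real.exp (θ * u) * (u ^ a / θ) + Real.exp (θ * u) ^ 2 * R u
          ≤ Real.exp 1 * (t ^ a / θ) + Real.exp 1 ^ 2 * t ^ a := by gcongr
        _ = _ := by ring)
  rwa [sub_zero, abs_of_nonneg ht] at h

/-- Small-time expansion of the covariance of the stationary fractional
Ornstein–Uhlenbeck process: `C(t) = β (1 - θ^{2H} t^{2H}/Γ(2H+1) + o(t^{2H}))` as `t → 0⁺`. -/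
theorem covariance_small_time_expansion (H θ : ℝ) (hH : H ∈ Set.Ioo (0:ℝ) 1) (hθ : 0 < θ) :
    Filter.Tendsto (fun t : ℝ =>
      t ^ (-(2*H)) *
        ((Real.exp (-θ*t) * (θ ^ (-(2*H)) * H * Real.Gamma (2*H))
          + (1/2) * Real.exp (-θ*t) * θ^2 *
              (∫ s in Set.Iio (0:ℝ), ∫ u in (0:ℝ)..t,
                (|s| ^ (2*H) + u ^ (2*H) - (u - s) ^ (2*H)) * Real.exp (θ * (u + s)))
          - (1/2) * θ * ∫ s in Set.Iio (0:ℝ),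
              (|s| ^ (2*H) + t ^ (2*H) - (t - s) ^ (2*H)) * Real.exp (θ * s))
        - (θ ^ (-(2*H)) * H * Real.Gamma (2*H)) *
            (1 - θ ^ (2*H) * t ^ (2*H) / Real.Gamma (2*H + 1))))
      (nhdsWithin 0 (Set.Ioi 0)) (nhds 0) := by
  obtain ⟨hH0, hH1⟩ := hH
  have ha : 0 < 2 * H := by linarith
  set β := θ ^ (-(2*H)) * H * Real.Gamma (2*H) with hβ
  have hΓ : 0 < Real.Gamma (2*H) := Real.Gamma_pos_of_pos ha
  have hβ0 : 0 < β := by positivity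
  have hG : ∫ v in Set.Ioi (0 : ℝ), v ^ (2*H) * Real.exp (-(θ * v)) = 2 * β / θ := by
    rw [integral_rpow_mul_exp_neg ha hθ, hβ]
    ring
  set M := Real.exp 1 / θ + Real.exp 1 ^ 2 with hM
  have hM0 : 0 < M := by positivity
  have hlim : Filter.Tendsto (fun t : ℝ => β * θ ^ 2 * t ^ (2 - 2*H) +
      (θ ^ 2 * M / 2 + θ * Real.exp 1 / 2) * t) (nhdsWithin 0 (Set.Ioi 0)) (nhds 0) := by
    have hc : Continuous fun t : ℝ => β * θ ^ 2 * t ^ (2 - 2*H) +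
        (θ ^ 2 * M / 2 + θ * Real.exp 1 / 2) * t :=
      (continuous_const.mul (continuous_id.rpow_const fun _ => Or.inr (by linarith))).add
        (by fun_prop)
    have h := (hc.tendsto 0).mono_left (nhdsWithin_le_nhds (s := Set.Ioi 0))
    rwa [Real.zero_rpow (by linarith), mul_zero, mul_zero, add_zero] at h
  refine squeeze_zero_norm' ?_ hlim
  have hpos : 0 < min 1 (1 / θ) := by positivity
  filter_upwards [Ioo_mem_nhdsGT hpos] with t ht
  obtain ⟨ht0, ht'⟩ := ht
  have ht1 : t ≤ 1 := (ht'.trans_le (min_le_left _ _)).le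
  have hθt : θ * t ≤ 1 := by
    have := (ht'.trans_le (min_le_right _ _)).le
    rwa [le_div_iff₀ hθ, mul_comm] at this
  have hJ := abs_integral_integral_fbm_covariance_sub_le ha hθ ht0.le ht1 hθt
  rw [integral_fbm_covariance_mul_exp ha hθ ht0.le]
  rw [hG] at hJ ⊢
  have hR0 := integral_rpow_mul_exp_neg_nonneg (a := 2*H) (θ := θ) ht0.le
  have hR1 := integral_rpow_mul_exp_neg_le ha hθ ht0.le
  set R := ∫ v in (0 : ℝ)..t, v ^ (2*H) * Real.exp (-(θ * v))
  set J := ∫ s in Set.Iio (0 : ℝ), ∫ u in (0 : ℝ)..t,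
        (|s| ^ (2*H) + u ^ (2*H) - (u - s) ^ (2*H)) * Real.exp (θ * (u + s))
  set J₀ := 2 * β / θ *
    ((Real.exp (θ * t) - 1) / θ - (Real.exp (θ * t) ^ 2 - 1) / (2 * θ)) with hJ₀
  have hcoef : β * (θ ^ (2*H) * t ^ (2*H) / Real.Gamma (2*H + 1)) = t ^ (2*H) / 2 := by
    rw [hβ, Real.Gamma_add_one ha.ne', Real.rpow_neg hθ.le]
    have : θ ^ (2*H) ≠ 0 := by positivity
    field_simp
  have hee : Real.exp (-θ * t) * Real.exp (θ * t) = 1 := by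
    rw [← Real.exp_add]; simp
  have hdecomp : Real.exp (-θ*t) * β + (1/2) * Real.exp (-θ*t) * θ^2 * J -
      (1/2) * θ * (2 * β / θ + t ^ (2*H) / θ - Real.exp (θ * t) * (2 * β / θ - R)) -
      β * (1 - θ ^ (2*H) * t ^ (2*H) / Real.Gamma (2*H + 1)) =
      β * ((Real.exp (θ * t) + Real.exp (-θ * t)) / 2 - 1) +
        (1/2) * Real.exp (-θ*t) * θ^2 * (J - J₀) - (1/2) * θ * (Real.exp (θ * t) * R) := by
    have h1 : (1/2) * Real.exp (-θ*t) * θ^2 * J₀ =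
        β * (1 - Real.exp (-θ * t) - (Real.exp (θ * t) - Real.exp (-θ * t)) / 2) := by
      rw [hJ₀]
      generalize Real.exp (-θ * t) = y at hee ⊢
      field_simp
      linear_combination (2 - Real.exp (θ * t)) * hee
    have h2 : (1/2) * θ * (2 * β / θ + t ^ (2*H) / θ - Real.exp (θ * t) * (2 * β / θ - R)) =
        β + t ^ (2*H) / 2 - Real.exp (θ * t) * β + (1/2) * θ * (Real.exp (θ * t) * R) := by
      field_simp
      ring
    rw [h2]
    linear_combination hcoef + h1
  have hcosh : |(Real.exp (θ * t) + Real.exp (-θ * t)) / 2 - 1| ≤ θ ^ 2 * t ^ 2 := by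
    have hθt0 : 0 ≤ θ * t := by positivity
    have h1 := abs_le.1 (Real.abs_exp_sub_one_sub_id_le (x := θ * t) (by rwa [abs_of_nonneg hθt0]))
    have h2 := abs_le.1 (Real.abs_exp_sub_one_sub_id_le (x := -θ * t)
      (by rwa [neg_mul, abs_neg, abs_of_nonneg hθt0]))
    rw [abs_le]
    constructor <;> nlinarith
  have hexp1 : Real.exp (-θ * t) ≤ 1 := by
    rw [Real.exp_le_one_iff]
    nlinarith
  have hexp2 : Real.exp (θ * t) ≤ Real.exp 1 := Real.exp_le_exp.2 hθt
  have hbound : |β * ((Real.exp (θ * t) + Real.exp (-θ * t)) / 2 - 1) +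
      (1/2) * Real.exp (-θ*t) * θ^2 * (J - J₀) - (1/2) * θ * (Real.exp (θ * t) * R)| ≤
      β * (θ ^ 2 * t ^ 2) + (1/2) * 1 * θ^2 * (M * t ^ (2*H) * t) +
        (1/2) * θ * (Real.exp 1 * (t ^ (2*H) * t)) := by
    refine (abs_sub _ _).trans (add_le_add ((abs_add_le _ _).trans (add_le_add ?_ ?_)) ?_)
    · rw [abs_mul, abs_of_pos hβ0]
      gcongr
    · rw [abs_mul, abs_of_pos (by positivity : 0 < (1/2) * Real.exp (-θ*t) * θ^2)]
      gcongr
    · rw [abs_of_nonneg (by positivity)]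
      gcongr
  rw [hdecomp, norm_mul, Real.norm_eq_abs, Real.norm_eq_abs,
    abs_of_pos (Real.rpow_pos_of_pos ht0 _)]
  refine (mul_le_mul_of_nonneg_left hbound (Real.rpow_nonneg ht0.le _)).trans (le_of_eq ?_)
  have hp1 : t ^ (-(2*H)) * t ^ (2*H) = 1 := by
    rw [← Real.rpow_add ht0]; simp
  have hp2 : t ^ (2 - 2*H) = t ^ (-(2*H)) * t ^ 2 := by
    rw [sub_eq_add_neg, Real.rpow_add ht0, Real.rpow_two, mul_comm]
  rw [hp2]
  linear_combination (θ ^ 2 * M / 2 + θ * Real.exp 1 / 2) * t * hp1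
end

section
/- Let H ∈ (3/4, 1), θ > 0 and n ≥ 0. Define A₁(T) = T^{3-4H} ∫_0^T ∫_0^{T-t} s^n e^{-θs} t^{2H-2} (s+t)^{2H-2} ds dt and A₂(T) = T^{3-4H} ∫_0^T ∫_0^T s^n e^{-θs} t^{2H-2} (s+t)^{2H-2} ds dt. Then lim_{T → ∞} A₁(T) = lim_{T → ∞} A₂(T) = θ^{-(n+1)} Γ(n+1) / (4H - 3), where Γ is the Gamma function. -/
open MeasureTheory

lemma integrableOn_pow_mul_exp_neg_mul_Ioi {θ : ℝ} (hθ : 0 < θ) (n : ℕ) :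
    IntegrableOn (fun s : ℝ => s ^ n * Real.exp (-θ * s)) (Set.Ioi 0) := by
  have h := integrableOn_rpow_mul_exp_neg_mul_rpow (p := 1) (s := n)
    (by linarith [n.cast_nonneg (α := ℝ)]) one_pos hθ
  simpa using h

lemma integral_pow_mul_exp_neg_mul_Ioi {θ : ℝ} (hθ : 0 < θ) (n : ℕ) :
    ∫ s in Set.Ioi (0 : ℝ), s ^ n * Real.exp (-θ * s) =
      θ ^ (-(n + 1) : ℤ) * Real.Gamma (n + 1) := by
  have h := Real.integral_rpow_mul_exp_neg_mul_Ioi (a := n + 1) (r := θ) (by positivity) hθ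
  have e : (1 / θ) ^ ((n : ℝ) + 1) = θ ^ (-(n + 1) : ℤ) := by
    rw [zpow_neg, one_div, Real.inv_rpow hθ.le]
    congr 1
    exact_mod_cast Real.rpow_natCast θ (n + 1)
  rw [← e, ← h]
  simp

/-- The kernel obtained from the double integral after rescaling the outer variable by `T`. -/
noncomputable def rescaledKernel (θ a : ℝ) (n : ℕ) (κ : ℝ → ℝ) (T u s : ℝ) : ℝ :=
  (Set.Iic (T * κ u)).indicator
    (fun s => s ^ n * Real.exp (-θ * s) * (u ^ a * (s / T + u) ^ a)) s

lemma norm_rescaledKernel_le {θ a : ℝ} (ha : a ≤ 0) (n : ℕ) (κ : ℝ → ℝ) {T u s : ℝ}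
    (hT : 0 < T) (hu : 0 < u) (hs : 0 < s) :
    ‖rescaledKernel θ a n κ T u s‖ ≤ u ^ (2 * a) * (s ^ n * Real.exp (-θ * s)) := by
  have h0 : 0 < s / T := div_pos hs hT
  refine (norm_indicator_le_norm_self _ _).trans ?_
  rw [Real.norm_of_nonneg (by positivity), mul_comm, two_mul, Real.rpow_add hu]
  gcongr ?_ * _
  gcongr _ * ?_
  exact Real.rpow_le_rpow_of_nonpos hu (by linarith) ha

lemma measurable_rescaledKernel (θ a : ℝ) (n : ℕ) {κ : ℝ → ℝ} (hκ : Measurable κ) (T : ℝ) :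
    Measurable (Function.uncurry (rescaledKernel θ a n κ T)) := by
  have hS : MeasurableSet {p : ℝ × ℝ | p.2 ≤ T * κ p.1} :=
    measurableSet_le measurable_snd (by fun_prop)
  have hf : Measurable fun p : ℝ × ℝ =>
      p.2 ^ n * Real.exp (-θ * p.2) * (p.1 ^ a * (p.2 / T + p.1) ^ a) := by fun_prop
  exact hf.indicator hS

lemma tendsto_rescaledKernel {θ a : ℝ} (n : ℕ) {κ : ℝ → ℝ} {u : ℝ} (hu : 0 < u)
    (hκ : 0 < κ u) (s : ℝ) :
    Filter.Tendsto (fun T => rescaledKernel θ a n κ T u s) Filter.atTop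
      (nhds (u ^ (2 * a) * (s ^ n * Real.exp (-θ * s)))) := by
  have h1 : Filter.Tendsto (fun T : ℝ => s / T + u) Filter.atTop (nhds u) := by
    simpa using (tendsto_const_nhds.div_atTop Filter.tendsto_id).add_const u
  have h2 := ((h1.rpow_const (p := a) (Or.inl hu.ne')).const_mul (u ^ a)).const_mul
    (s ^ n * Real.exp (-θ * s))
  rw [← Real.rpow_add hu, ← two_mul, mul_comm (s ^ n * _)] at h2
  refine h2.congr' ?_
  filter_upwards [(Filter.tendsto_id.atTop_mul_const hκ).eventually_ge_atTop s] with T hT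
  have hs : s ∈ Set.Iic (T * κ u) := hT
  simp only [rescaledKernel, Set.indicator_of_mem hs]

lemma tendsto_integral_rescaledKernel {θ a : ℝ} (hθ : 0 < θ) (ha : a ≤ 0) (ha' : -1 < 2 * a)
    (n : ℕ) {κ : ℝ → ℝ} (hκm : Measurable κ) (hκ : ∀ u ∈ Set.Ioo (0 : ℝ) 1, 0 < κ u) :
    Filter.Tendsto
      (fun T => ∫ u in Set.Ioo (0 : ℝ) 1, ∫ s in Set.Ioi (0 : ℝ), rescaledKernel θ a n κ T u s)
      Filter.atTop (nhds (θ ^ (-(n + 1) : ℤ) * Real.Gamma (n + 1) / (2 * a + 1))) := by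
  have hint := integrableOn_pow_mul_exp_neg_mul_Ioi hθ n
  set C := ∫ s in Set.Ioi (0 : ℝ), s ^ n * Real.exp (-θ * s) with hC
  have hlim : ∫ u in Set.Ioo (0 : ℝ) 1, u ^ (2 * a) * C =
      θ ^ (-(n + 1) : ℤ) * Real.Gamma (n + 1) / (2 * a + 1) := by
    rw [integral_mul_const, ← integral_Ioc_eq_integral_Ioo,
      ← intervalIntegral.integral_of_le zero_le_one, integral_rpow (Or.inl ha'), hC,
      integral_pow_mul_exp_neg_mul_Ioi hθ, Real.one_rpow,
      Real.zero_rpow (by linarith : 2 * a + 1 ≠ 0)]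
    ring
  rw [← hlim]
  refine tendsto_integral_filter_of_dominated_convergence (fun u => u ^ (2 * a) * C) ?_ ?_ ?_ ?_
  · exact Filter.Eventually.of_forall fun T =>
      (measurable_rescaledKernel θ a n hκm T).stronglyMeasurable.integral_prod_right
        |>.aestronglyMeasurable
  · filter_upwards [Filter.eventually_gt_atTop 0] with T hT
    filter_upwards [ae_restrict_mem measurableSet_Ioo] with u hu
    rw [hC, ← integral_const_mul]
    refine norm_integral_le_of_norm_le (hint.const_mul _) ?_
    filter_upwards [ae_restrict_mem measurableSet_Ioi] with s hs
    exact norm_rescaledKernel_le ha n κ hT hu.1 hs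
  · refine Integrable.mul_const ?_ C
    exact ((intervalIntegrable_iff_integrableOn_Ioo_of_le zero_le_one).1
      (intervalIntegral.intervalIntegrable_rpow' ha'))
  · filter_upwards [ae_restrict_mem measurableSet_Ioo] with u hu
    rw [hC, ← integral_const_mul]
    refine tendsto_integral_filter_of_dominated_convergence
      (fun s => u ^ (2 * a) * (s ^ n * Real.exp (-θ * s))) ?_ ?_ (hint.const_mul _) ?_
    · exact Filter.Eventually.of_forall fun T =>
        ((measurable_rescaledKernel θ a n hκm T).of_uncurry_left).aestronglyMeasurable
    · filter_upwards [Filter.eventually_gt_atTop 0] with T hT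
      filter_upwards [ae_restrict_mem measurableSet_Ioi] with s hs
      exact norm_rescaledKernel_le ha n κ hT hu.1 hs
    · exact Filter.Eventually.of_forall fun s => tendsto_rescaledKernel n hu.1 (hκ u hu) s

lemma rpow_mul_integral_eq_integral_rescaledKernel (θ a : ℝ) (n : ℕ) {κ : ℝ → ℝ}
    (hκ : ∀ u ∈ Set.Ioo (0 : ℝ) 1, 0 < κ u) {T : ℝ} (hT : 0 < T) :
    (T ^ (-(2 * a + 1)) * ∫ t in (0 : ℝ)..T, ∫ s in (0 : ℝ)..(T * κ (t / T)),
      s ^ n * Real.exp (-θ * s) * t ^ a * (s + t) ^ a) =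
    ∫ u in Set.Ioo (0 : ℝ) 1, ∫ s in Set.Ioi (0 : ℝ), rescaledKernel θ a n κ T u s := by
  have hscale := intervalIntegral.mul_integral_comp_mul_left (a := 0) (b := 1)
    (f := fun t => ∫ s in (0 : ℝ)..(T * κ (t / T)),
      s ^ n * Real.exp (-θ * s) * t ^ a * (s + t) ^ a) T
  rw [mul_zero, mul_one] at hscale
  rw [← hscale, ← mul_assoc, intervalIntegral.integral_of_le zero_le_one,
    integral_Ioc_eq_integral_Ioo, ← integral_const_mul]
  refine setIntegral_congr_fun measurableSet_Ioo fun u hu => ?_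
  have hu0 := hu.1
  have hκu : 0 ≤ T * κ u := (mul_pos hT (hκ u hu)).le
  simp only [rescaledKernel]
  rw [setIntegral_indicator measurableSet_Iic, Set.Ioi_inter_Iic, mul_div_cancel_left₀ _ hT.ne',
    intervalIntegral.integral_of_le hκu, ← integral_const_mul]
  refine setIntegral_congr_fun measurableSet_Ioc fun s hs => ?_
  have hs0 : 0 < s := hs.1
  have hst : s + T * u = T * (s / T + u) := by field_simp
  have hpow : T ^ (-(2 * a + 1)) * T * (T ^ a * T ^ a) = 1 := by
    rw [← Real.rpow_add hT, ← Real.rpow_add_one hT.ne', ← Real.rpow_add hT]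
    ring_nf
    exact Real.rpow_zero T
  rw [hst, Real.mul_rpow hT.le hu0.le, Real.mul_rpow hT.le (by positivity)]
  linear_combination (s ^ n * Real.exp (-θ * s) * (u ^ a * (s / T + u) ^ a)) * hpow

lemma tendsto_rpow_mul_integral {θ a : ℝ} (hθ : 0 < θ) (ha : a ≤ 0) (ha' : -1 < 2 * a)
    (n : ℕ) {κ : ℝ → ℝ} (hκm : Measurable κ) (hκ : ∀ u ∈ Set.Ioo (0 : ℝ) 1, 0 < κ u) :
    Filter.Tendsto (fun T : ℝ =>
      T ^ (-(2 * a + 1)) * ∫ t in (0 : ℝ)..T, ∫ s in (0 : ℝ)..(T * κ (t / T)),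
        s ^ n * Real.exp (-θ * s) * t ^ a * (s + t) ^ a)
      Filter.atTop (nhds (θ ^ (-(n + 1) : ℤ) * Real.Gamma (n + 1) / (2 * a + 1))) := by
  refine (tendsto_integral_rescaledKernel hθ ha ha' n hκm hκ).congr' ?_
  filter_upwards [Filter.eventually_gt_atTop 0] with T hT
  exact (rpow_mul_integral_eq_integral_rescaledKernel θ a n hκ hT).symm

/-- Limits of the double integrals `A₁(T)`, `A₂(T)` for `H ∈ (3/4, 1)`. -/
theorem limit_A1_A2_supercritical (H θ : ℝ) (n : ℕ) (hH : H ∈ Set.Ioo (3/4 : ℝ) 1)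
    (hθ : 0 < θ) :
    Filter.Tendsto (fun T : ℝ =>
      T ^ (3 - 4*H) * ∫ t in (0:ℝ)..T, ∫ s in (0:ℝ)..(T - t),
        s ^ n * Real.exp (-θ*s) * t ^ (2*H - 2) * (s + t) ^ (2*H - 2))
      Filter.atTop (nhds (θ ^ (-(n+1) : ℤ) * Real.Gamma (n+1) / (4*H - 3)))
    ∧
    Filter.Tendsto (fun T : ℝ =>
      T ^ (3 - 4*H) * ∫ t in (0:ℝ)..T, ∫ s in (0:ℝ)..T,
        s ^ n * Real.exp (-θ*s) * t ^ (2*H - 2) * (s + t) ^ (2*H - 2))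
      Filter.atTop (nhds (θ ^ (-(n+1) : ℤ) * Real.Gamma (n+1) / (4*H - 3))) := by
  obtain ⟨h1, h2⟩ := hH
  have ha : 2 * H - 2 ≤ 0 := by linarith
  have ha' : -1 < 2 * (2 * H - 2) := by linarith
  have e1 : 3 - 4 * H = -(2 * (2 * H - 2) + 1) := by ring
  have e2 : 4 * H - 3 = 2 * (2 * H - 2) + 1 := by ring
  rw [e1, e2]
  constructor
  · refine (tendsto_rpow_mul_integral hθ ha ha' n (κ := fun u => 1 - u) (by fun_prop)
      fun u hu => sub_pos.2 hu.2).congr' ?_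
    filter_upwards [Filter.eventually_gt_atTop 0] with T hT
    have h (t : ℝ) : T * (1 - t / T) = T - t := by field_simp
    simp only [h]
  · simpa only [mul_one] using tendsto_rpow_mul_integral hθ ha ha' n (κ := fun _ => 1)
      measurable_const fun _ _ => one_pos
end

section
/- Let H = 3/4, θ > 0 and n ≥ 0. Define A₁(T) = T^{3-4H} ∫_0^T ∫_0^{T-t} s^n e^{-θs} t^{2H-2} (s+t)^{2H-2} ds dt and A₂(T) = T^{3-4H} ∫_0^T ∫_0^T s^n e^{-θs} t^{2H-2} (s+t)^{2H-2} ds dt (so with H = 3/4 the prefactor is T^0 = 1 and the exponents 2H-2 equal -1/2). Then lim_{T → ∞} A₁(T)/log T = lim_{T → ∞} A₂(T)/log T = Γ(n+1) θ^{-(n+1)}, where Γ is the Gamma function. -/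
open MeasureTheory

section CriticalKernel

open Set Filter intervalIntegral

variable {f : ℝ → ℝ}

lemma integrableOn_mul_add_rpow_neg_half {t : ℝ} (hf0 : ∀ s, 0 < s → 0 ≤ f s)
    (hfi : IntegrableOn f (Ioi 0))
    (hfh : IntegrableOn (fun s => s ^ (-1 / 2 : ℝ) * f s) (Ioi 0)) (ht : 0 ≤ t) :
    IntegrableOn (fun s => f s * (s + t) ^ (-1 / 2 : ℝ)) (Ioi 0) := by
  refine Integrable.mono' hfh (hfi.aestronglyMeasurable.mul
    (by fun_prop : Measurable fun s : ℝ => (s + t) ^ (-1 / 2 : ℝ)).aestronglyMeasurable) ?_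
  filter_upwards [ae_restrict_mem measurableSet_Ioi] with s (hs : 0 < s)
  have h0 := hf0 s hs
  rw [Real.norm_of_nonneg (by positivity), mul_comm]
  exact mul_le_mul_of_nonneg_right
    (Real.rpow_le_rpow_of_nonpos hs (by linarith) (by norm_num)) h0

lemma integral_mul_add_rpow_neg_half_le_integral_rpow_mul {t B : ℝ}
    (hf0 : ∀ s, 0 < s → 0 ≤ f s) (hfi : IntegrableOn f (Ioi 0))
    (hfh : IntegrableOn (fun s => s ^ (-1 / 2 : ℝ) * f s) (Ioi 0)) (ht : 0 ≤ t) (hB : 0 ≤ B) :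
    ∫ s in (0 : ℝ)..B, f s * (s + t) ^ (-1 / 2 : ℝ) ≤ ∫ s in Ioi 0, s ^ (-1 / 2 : ℝ) * f s := by
  have hi := integrableOn_mul_add_rpow_neg_half hf0 hfi hfh ht
  rw [integral_of_le hB]
  refine (setIntegral_mono_set hi ?_ Ioc_subset_Ioi_self.eventuallyLE).trans
    (setIntegral_mono_on hi hfh measurableSet_Ioi fun s (hs : 0 < s) => ?_)
  · filter_upwards [ae_restrict_mem measurableSet_Ioi] with s (hs : 0 < s)
    have h0 := hf0 s hs
    simp only [Pi.zero_apply]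
    positivity
  · rw [mul_comm]
    exact mul_le_mul_of_nonneg_right
      (Real.rpow_le_rpow_of_nonpos hs (by linarith) (by norm_num)) (hf0 s hs)

lemma integral_mul_add_rpow_neg_half_le {t B : ℝ}
    (hf0 : ∀ s, 0 < s → 0 ≤ f s) (hfi : IntegrableOn f (Ioi 0))
    (hfh : IntegrableOn (fun s => s ^ (-1 / 2 : ℝ) * f s) (Ioi 0)) (ht : 0 < t) (hB : 0 ≤ B) :
    ∫ s in (0 : ℝ)..B, f s * (s + t) ^ (-1 / 2 : ℝ) ≤
      (∫ s in Ioi 0, f s) * t ^ (-1 / 2 : ℝ) := by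
  have hi := integrableOn_mul_add_rpow_neg_half hf0 hfi hfh ht.le
  rw [integral_of_le hB, ← MeasureTheory.integral_mul_const]
  refine (setIntegral_mono_set hi ?_ Ioc_subset_Ioi_self.eventuallyLE).trans
    (setIntegral_mono_on hi (hfi.mul_const _) measurableSet_Ioi fun s (hs : 0 < s) => ?_)
  · filter_upwards [ae_restrict_mem measurableSet_Ioi] with s (hs : 0 < s)
    have h0 := hf0 s hs
    simp only [Pi.zero_apply]
    positivity
  · exact mul_le_mul_of_nonneg_left
      (Real.rpow_le_rpow_of_nonpos ht (by linarith) (by norm_num)) (hf0 s hs)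

lemma rpow_neg_half_mul_self {t : ℝ} (ht : 0 < t) :
    t ^ (-1 / 2 : ℝ) * t ^ (-1 / 2 : ℝ) = t⁻¹ := by
  rw [← Real.rpow_add ht, ← Real.rpow_neg_one]
  norm_num

/-- The weight `t⁻¹ - s t⁻²` is negative for `s > t`, so cutting off at `B ≥ t` only helps. -/
lemma le_rpow_mul_integral_mul_add_rpow_neg_half {t B : ℝ}
    (hf0 : ∀ s, 0 < s → 0 ≤ f s) (hfi : IntegrableOn f (Ioi 0))
    (hf1 : IntegrableOn (fun s => s * f s) (Ioi 0))
    (hfh : IntegrableOn (fun s => s ^ (-1 / 2 : ℝ) * f s) (Ioi 0)) (ht : 0 < t) (hB : t ≤ B) :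
    (∫ s in Ioi 0, f s) * t⁻¹ - (∫ s in Ioi 0, s * f s) * (t ^ 2)⁻¹ ≤
      t ^ (-1 / 2 : ℝ) * ∫ s in (0 : ℝ)..B, f s * (s + t) ^ (-1 / 2 : ℝ) := by
  have hi := integrableOn_mul_add_rpow_neg_half hf0 hfi hfh ht.le
  have hset : Ioc 0 B = Ioi 0 ∩ Iic B := Ioi_inter_Iic.symm
  rw [integral_of_le (ht.le.trans hB), ← MeasureTheory.integral_mul_const,
    ← MeasureTheory.integral_mul_const, ← MeasureTheory.integral_const_mul,
    ← MeasureTheory.integral_sub (hfi.mul_const _) (hf1.mul_const _), hset,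
    ← setIntegral_indicator measurableSet_Iic]
  refine setIntegral_mono_on ((hfi.mul_const _).sub (hf1.mul_const _))
    ((hi.const_mul _).indicator measurableSet_Iic) measurableSet_Ioi fun s (hs : 0 < s) => ?_
  have h0 := hf0 s hs
  have key : f s * t⁻¹ - s * f s * (t ^ 2)⁻¹ = f s * ((t - s) / t ^ 2) := by
    field_simp
  by_cases hsB : s ≤ B
  · rw [indicator_of_mem (show s ∈ Iic B from hsB), key, mul_left_comm]
    refine mul_le_mul_of_nonneg_left ?_ h0
    calc (t - s) / t ^ 2 ≤ (s + t)⁻¹ := by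
          rw [div_le_iff₀ (by positivity), inv_mul_eq_div, le_div_iff₀ (by positivity)]
          nlinarith [sq_nonneg s]
      _ = (s + t) ^ (-1 / 2 : ℝ) * (s + t) ^ (-1 / 2 : ℝ) :=
          (rpow_neg_half_mul_self (by positivity)).symm
      _ ≤ t ^ (-1 / 2 : ℝ) * (s + t) ^ (-1 / 2 : ℝ) :=
          mul_le_mul_of_nonneg_right
            (Real.rpow_le_rpow_of_nonpos ht (by linarith) (by norm_num)) (by positivity)
  · rw [indicator_of_notMem (show s ∉ Iic B from hsB), key]
    exact mul_nonpos_of_nonneg_of_nonpos h0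
      (div_nonpos_of_nonpos_of_nonneg (by linarith) (by positivity))

lemma antitoneOn_integral_mul_add_rpow_neg_half {T : ℝ} {b : ℝ → ℝ}
    (hf0 : ∀ s, 0 < s → 0 ≤ f s) (hfi : IntegrableOn f (Ioi 0))
    (hfh : IntegrableOn (fun s => s ^ (-1 / 2 : ℝ) * f s) (Ioi 0))
    (hb : AntitoneOn b (Icc 0 T)) (hbT : ∀ t ∈ Icc 0 T, 0 ≤ b t) :
    AntitoneOn (fun t => ∫ s in (0 : ℝ)..b t, f s * (s + t) ^ (-1 / 2 : ℝ)) (Icc 0 T) := by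
  intro t ht u hu htu
  have hit := integrableOn_mul_add_rpow_neg_half hf0 hfi hfh ht.1
  have hiu := integrableOn_mul_add_rpow_neg_half hf0 hfi hfh hu.1
  simp only
  rw [integral_of_le (hbT t ht), integral_of_le (hbT u hu)]
  refine (setIntegral_mono_on (hiu.mono_set Ioc_subset_Ioi_self)
    (hit.mono_set Ioc_subset_Ioi_self) measurableSet_Ioc fun s hs => ?_).trans
    (setIntegral_mono_set (hit.mono_set Ioc_subset_Ioi_self) ?_
      (Ioc_subset_Ioc_right (hb ht hu htu)).eventuallyLE)
  · exact mul_le_mul_of_nonneg_left (Real.rpow_le_rpow_of_nonpos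
      (add_pos_of_pos_of_nonneg hs.1 ht.1) (by linarith) (by norm_num)) (hf0 s hs.1)
  · filter_upwards [ae_restrict_mem measurableSet_Ioc] with s hs
    exact mul_nonneg (hf0 s hs.1) (Real.rpow_nonneg (add_nonneg hs.1.le ht.1) _)

lemma intervalIntegrable_rpow_mul_integral {T : ℝ} {b : ℝ → ℝ}
    (hf0 : ∀ s, 0 < s → 0 ≤ f s) (hfi : IntegrableOn f (Ioi 0))
    (hfh : IntegrableOn (fun s => s ^ (-1 / 2 : ℝ) * f s) (Ioi 0)) (hT : 0 ≤ T)
    (hb : AntitoneOn b (Icc 0 T)) (hbT : ∀ t ∈ Icc 0 T, 0 ≤ b t) :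
    IntervalIntegrable
      (fun t => t ^ (-1 / 2 : ℝ) * ∫ s in (0 : ℝ)..b t, f s * (s + t) ^ (-1 / 2 : ℝ))
      volume 0 T := by
  have hJ : IntervalIntegrable
      (fun t => ∫ s in (0 : ℝ)..b t, f s * (s + t) ^ (-1 / 2 : ℝ)) volume 0 T :=
    AntitoneOn.intervalIntegrable (by
      rw [uIcc_of_le hT]
      exact antitoneOn_integral_mul_add_rpow_neg_half hf0 hfi hfh hb hbT)
  have hp : IntervalIntegrable (fun t : ℝ => t ^ (-1 / 2 : ℝ)) volume 0 T :=
    intervalIntegrable_rpow' (by norm_num)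
  rw [intervalIntegrable_iff_integrableOn_Ioc_of_le hT] at hJ hp ⊢
  refine Integrable.mul_bdd (c := ∫ s in Ioi 0, s ^ (-1 / 2 : ℝ) * f s) hp
    hJ.aestronglyMeasurable ?_
  filter_upwards [ae_restrict_mem measurableSet_Ioc] with t ht
  have ht' : t ∈ Icc 0 T := Ioc_subset_Icc_self ht
  rw [Real.norm_of_nonneg]
  · exact integral_mul_add_rpow_neg_half_le_integral_rpow_mul hf0 hfi hfh ht.1.le (hbT t ht')
  · rw [integral_of_le (hbT t ht')]
    exact setIntegral_nonneg measurableSet_Ioc fun s hs =>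
      mul_nonneg (hf0 s hs.1) (Real.rpow_nonneg (add_nonneg hs.1.le ht'.1) _)

lemma integral_rpow_mul_integral_le {T : ℝ} {b : ℝ → ℝ}
    (hf0 : ∀ s, 0 < s → 0 ≤ f s) (hfi : IntegrableOn f (Ioi 0))
    (hfh : IntegrableOn (fun s => s ^ (-1 / 2 : ℝ) * f s) (Ioi 0)) (hT : 1 ≤ T)
    (hb : AntitoneOn b (Icc 0 T)) (hbT : ∀ t ∈ Icc 0 T, 0 ≤ b t) :
    ∫ t in (0 : ℝ)..T, t ^ (-1 / 2 : ℝ) * ∫ s in (0 : ℝ)..b t, f s * (s + t) ^ (-1 / 2 : ℝ) ≤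
      2 * (∫ s in Ioi 0, s ^ (-1 / 2 : ℝ) * f s) + (∫ s in Ioi 0, f s) * Real.log T := by
  have hT0 : 0 ≤ T := zero_le_one.trans hT
  have hi := intervalIntegrable_rpow_mul_integral hf0 hfi hfh hT0 hb hbT
  have hi1 := hi.mono_set (c := 0) (d := 1) (by
    rw [uIcc_of_le hT0, uIcc_of_le zero_le_one]; exact Icc_subset_Icc_right hT)
  have hi2 := hi.mono_set (c := 1) (d := T) (by
    rw [uIcc_of_le hT0, uIcc_of_le hT]; exact Icc_subset_Icc_left zero_le_one)
  rw [← integral_add_adjacent_intervals hi1 hi2]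
  refine add_le_add ?_ ?_
  · calc _ ≤ ∫ t in (0 : ℝ)..1, t ^ (-1 / 2 : ℝ) * ∫ s in Ioi 0, s ^ (-1 / 2 : ℝ) * f s := by
          refine integral_mono_on zero_le_one hi1
            ((intervalIntegrable_rpow' (by norm_num)).mul_const _) fun t ht => ?_
          exact mul_le_mul_of_nonneg_left
            (integral_mul_add_rpow_neg_half_le_integral_rpow_mul hf0 hfi hfh ht.1
              (hbT t ⟨ht.1, ht.2.trans hT⟩)) (Real.rpow_nonneg ht.1 _)
      _ = _ := by
          rw [intervalIntegral.integral_mul_const, integral_rpow (Or.inl (by norm_num))]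
          norm_num
  · have h0 : (0 : ℝ) ∉ uIcc 1 T := by
      rw [uIcc_of_le hT]
      exact fun h => absurd h.1 (by norm_num)
    calc _ ≤ ∫ t in (1 : ℝ)..T, (∫ s in Ioi 0, f s) * t⁻¹ := by
          refine integral_mono_on hT hi2
            ((intervalIntegrable_inv_iff.2 (Or.inr h0)).const_mul _) fun t ht => ?_
          have ht0 : 0 < t := zero_lt_one.trans_le ht.1
          rw [← rpow_neg_half_mul_self ht0, mul_left_comm]
          exact mul_le_mul_of_nonneg_left
            (integral_mul_add_rpow_neg_half_le hf0 hfi hfh ht0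
              (hbT t ⟨ht0.le, ht.2⟩)) (by positivity)
      _ = _ := by
          rw [intervalIntegral.integral_const_mul, integral_inv h0, div_one]

lemma le_integral_rpow_mul_integral {T : ℝ} {b : ℝ → ℝ}
    (hf0 : ∀ s, 0 < s → 0 ≤ f s) (hfi : IntegrableOn f (Ioi 0))
    (hf1 : IntegrableOn (fun s => s * f s) (Ioi 0))
    (hfh : IntegrableOn (fun s => s ^ (-1 / 2 : ℝ) * f s) (Ioi 0)) (hT : 2 ≤ T)
    (hb : AntitoneOn b (Icc 0 T)) (hbT : ∀ t ∈ Icc 0 T, T - t ≤ b t) :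
    (∫ s in Ioi 0, f s) * Real.log (T / 2) - (∫ s in Ioi 0, s * f s) ≤
      ∫ t in (0 : ℝ)..T, t ^ (-1 / 2 : ℝ) *
        ∫ s in (0 : ℝ)..b t, f s * (s + t) ^ (-1 / 2 : ℝ) := by
  have hT0 : 0 ≤ T := by linarith
  have hT2 : 1 ≤ T / 2 := by linarith
  have hb0 : ∀ t ∈ Icc 0 T, 0 ≤ b t := fun t ht => (sub_nonneg.2 ht.2).trans (hbT t ht)
  have hi := intervalIntegrable_rpow_mul_integral hf0 hfi hfh hT0 hb hb0
  have hi2 := hi.mono_set (c := 1) (d := T / 2) (by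
    rw [uIcc_of_le hT0, uIcc_of_le hT2]; exact Icc_subset_Icc zero_le_one (by linarith))
  have h0 : (0 : ℝ) ∉ uIcc 1 (T / 2) := by
    rw [uIcc_of_le hT2]
    exact fun h => absurd h.1 (by norm_num)
  have hM : 0 ≤ ∫ s in Ioi 0, s * f s :=
    setIntegral_nonneg measurableSet_Ioi fun s (hs : 0 < s) => mul_nonneg hs.le (hf0 s hs)
  have hinv : IntervalIntegrable (fun t : ℝ => t⁻¹) volume 1 (T / 2) :=
    intervalIntegrable_inv_iff.2 (Or.inr h0)
  have hsq : IntervalIntegrable (fun t : ℝ => (t ^ 2)⁻¹) volume 1 (T / 2) :=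
    ContinuousOn.intervalIntegrable (ContinuousOn.inv₀ (by fun_prop) fun t ht =>
      pow_ne_zero 2 fun h => h0 (h ▸ ht))
  have hsqv : ∫ t in (1 : ℝ)..T / 2, (t ^ 2)⁻¹ ≤ 1 := by
    have h := integral_zpow (a := 1) (b := T / 2) (n := -2) (Or.inr ⟨by norm_num, h0⟩)
    have hpos : 0 < (T / 2)⁻¹ := by positivity
    have he : ∫ t in (1 : ℝ)..T / 2, (t ^ 2)⁻¹ = ∫ t in (1 : ℝ)..T / 2, t ^ (-2 : ℤ) :=
      intervalIntegral.integral_congr fun t _ => by simp [zpow_neg]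
    have he' : (-2 + 1 : ℤ) = -1 := by norm_num
    rw [he, h, he', zpow_neg_one, one_zpow]
    norm_num [-inv_div]
    linarith
  calc _ ≤ ∫ t in (1 : ℝ)..T / 2,
        ((∫ s in Ioi 0, f s) * t⁻¹ - (∫ s in Ioi 0, s * f s) * (t ^ 2)⁻¹) := by
        rw [intervalIntegral.integral_sub (hinv.const_mul _) (hsq.const_mul _),
          intervalIntegral.integral_const_mul, intervalIntegral.integral_const_mul,
          integral_inv h0, div_one]
        have := mul_le_mul_of_nonneg_left hsqv hM
        linarith
    _ ≤ ∫ t in (1 : ℝ)..T / 2, t ^ (-1 / 2 : ℝ) *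
        ∫ s in (0 : ℝ)..b t, f s * (s + t) ^ (-1 / 2 : ℝ) := by
        refine integral_mono_on hT2 ((hinv.const_mul _).sub (hsq.const_mul _)) hi2 fun t ht => ?_
        have ht0 : 0 < t := zero_lt_one.trans_le ht.1
        have ht2 := ht.2
        have := hbT t ⟨ht0.le, by linarith⟩
        exact le_rpow_mul_integral_mul_add_rpow_neg_half hf0 hfi hf1 hfh ht0 (by linarith)
    _ ≤ _ := by
        refine integral_mono_interval zero_le_one hT2 (by linarith) ?_ hi
        filter_upwards [ae_restrict_mem measurableSet_Ioc] with t ht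
        refine mul_nonneg (Real.rpow_nonneg ht.1.le _) ?_
        rw [integral_of_le (hb0 t (Ioc_subset_Icc_self ht))]
        exact setIntegral_nonneg measurableSet_Ioc fun s hs =>
          mul_nonneg (hf0 s hs.1) (Real.rpow_nonneg (add_nonneg hs.1.le ht.1.le) _)

theorem tendsto_integral_mul_rpow_neg_half_div_log {b : ℝ → ℝ → ℝ}
    (hf0 : ∀ s, 0 < s → 0 ≤ f s) (hfi : IntegrableOn f (Ioi 0))
    (hf1 : IntegrableOn (fun s => s * f s) (Ioi 0))
    (hfh : IntegrableOn (fun s => s ^ (-1 / 2 : ℝ) * f s) (Ioi 0))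
    (hb : ∀ T, AntitoneOn (b T) (Icc 0 T)) (hbT : ∀ T, ∀ t ∈ Icc 0 T, T - t ≤ b T t) :
    Tendsto (fun T : ℝ => (∫ t in (0 : ℝ)..T, ∫ s in (0 : ℝ)..b T t,
        f s * t ^ (-1 / 2 : ℝ) * (s + t) ^ (-1 / 2 : ℝ)) / Real.log T)
      atTop (nhds (∫ s in Ioi 0, f s)) := by
  have hfac : ∀ T t : ℝ, ∫ s in (0 : ℝ)..b T t, f s * t ^ (-1 / 2 : ℝ) * (s + t) ^ (-1 / 2 : ℝ) =
      t ^ (-1 / 2 : ℝ) * ∫ s in (0 : ℝ)..b T t, f s * (s + t) ^ (-1 / 2 : ℝ) := fun T t => by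
    rw [← intervalIntegral.integral_const_mul]
    congr 1
    ext s
    ring
  simp only [hfac]
  have hlim : ∀ c : ℝ, Tendsto (fun T => c / Real.log T + ∫ s in Ioi 0, f s) atTop
      (nhds (∫ s in Ioi 0, f s)) := fun c => by
    simpa using (Real.tendsto_log_atTop.const_div_atTop c).add_const (∫ s in Ioi 0, f s)
  refine tendsto_of_tendsto_of_tendsto_of_le_of_le'
    (hlim (-(∫ s in Ioi 0, f s) * Real.log 2 - ∫ s in Ioi 0, s * f s))
    (hlim (2 * ∫ s in Ioi 0, s ^ (-1 / 2 : ℝ) * f s)) ?_ ?_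
  · filter_upwards [eventually_ge_atTop 2] with T hT
    have hlog : 0 < Real.log T := Real.log_pos (by linarith)
    have h := le_integral_rpow_mul_integral hf0 hfi hf1 hfh hT (hb T) (hbT T)
    rw [Real.log_div (by linarith) two_ne_zero] at h
    rw [div_add' _ _ _ hlog.ne']
    gcongr
    linarith
  · filter_upwards [eventually_ge_atTop 2] with T hT
    have hlog : 0 < Real.log T := Real.log_pos (by linarith)
    rw [div_add' _ _ _ hlog.ne']
    gcongr
    exact integral_rpow_mul_integral_le hf0 hfi hfh (by linarith) (hb T)
      fun t ht => (sub_nonneg.2 ht.2).trans (hbT T t ht)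

end CriticalKernel

/-- Logarithmic-rate limits of the double integrals `A₁(T)`, `A₂(T)` at `H = 3/4`. -/
theorem limit_A1_A2_critical (H θ : ℝ) (n : ℕ) (hH : H = 3/4) (hθ : 0 < θ) :
    Filter.Tendsto (fun T : ℝ =>
      (T ^ (3 - 4*H) * ∫ t in (0:ℝ)..T, ∫ s in (0:ℝ)..(T - t),
        s ^ n * Real.exp (-θ*s) * t ^ (2*H - 2) * (s + t) ^ (2*H - 2)) / Real.log T)
      Filter.atTop (nhds (Real.Gamma (n+1) * θ ^ (-(n+1) : ℤ)))
    ∧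
    Filter.Tendsto (fun T : ℝ =>
      (T ^ (3 - 4*H) * ∫ t in (0:ℝ)..T, ∫ s in (0:ℝ)..T,
        s ^ n * Real.exp (-θ*s) * t ^ (2*H - 2) * (s + t) ^ (2*H - 2)) / Real.log T)
      Filter.atTop (nhds (Real.Gamma (n+1) * θ ^ (-(n+1) : ℤ))) := by
  subst hH
  have hint : ∀ q : ℝ, -1 < q →
      IntegrableOn (fun s : ℝ => s ^ q * Real.exp (-θ * s)) (Set.Ioi 0) := fun q hq => by
    simpa using integrableOn_rpow_mul_exp_neg_mul_rpow hq one_pos hθ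
  have hf0 : ∀ s : ℝ, 0 < s → 0 ≤ s ^ n * Real.exp (-θ * s) := fun s hs => by positivity
  have hn : (0 : ℝ) ≤ n := n.cast_nonneg
  have hfi : IntegrableOn (fun s : ℝ => s ^ n * Real.exp (-θ * s)) (Set.Ioi 0) := by
    simpa using hint n (by linarith)
  have hf1 : IntegrableOn (fun s : ℝ => s * (s ^ n * Real.exp (-θ * s))) (Set.Ioi 0) := by
    refine (hint (n + 1) (by linarith)).congr_fun (fun s (hs : 0 < s) => ?_) measurableSet_Ioi
    simp only [Real.rpow_add hs, Real.rpow_natCast, Real.rpow_one]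
    ring
  have hfh : IntegrableOn (fun s : ℝ => s ^ (-1 / 2 : ℝ) * (s ^ n * Real.exp (-θ * s)))
      (Set.Ioi 0) := by
    refine (hint (n + -1 / 2) (by linarith)).congr_fun (fun s (hs : 0 < s) => ?_)
      measurableSet_Ioi
    simp only [Real.rpow_add hs, Real.rpow_natCast]
    ring
  have hval : ∫ s in Set.Ioi (0 : ℝ), s ^ n * Real.exp (-θ * s) =
      Real.Gamma (n + 1) * θ ^ (-(n + 1) : ℤ) := by
    have h := Real.integral_rpow_mul_exp_neg_mul_Ioi (a := n + 1) (by positivity) hθ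
    simp only [add_sub_cancel_right, Real.rpow_natCast, ← neg_mul] at h
    rw [h, mul_comm, zpow_neg, one_div, Real.inv_rpow hθ.le]
    norm_cast
  have he1 : (3 - 4 * (3 / 4) : ℝ) = 0 := by norm_num
  have he2 : (2 * (3 / 4) - 2 : ℝ) = -1 / 2 := by norm_num
  simp only [he1, he2, Real.rpow_zero, one_mul]
  rw [← hval]
  exact ⟨tendsto_integral_mul_rpow_neg_half_div_log (b := fun T t => T - t) hf0 hfi hf1 hfh
      (fun T t _ u _ htu => sub_le_sub_left htu T) fun T t _ => le_rfl,
    tendsto_integral_mul_rpow_neg_half_div_log (b := fun T _ => T) hf0 hfi hf1 hfh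
      (fun T => antitoneOn_const) fun T t ht => sub_le_self T ht.1⟩
end

section
/- Let H ∈ (0, 1/2) and 0 < α < 1/2, and define f_α(ξ, η, η') = |ξ-η|^{α-1} |ξ-η'|^{α-1} ξ^{1-2H} for ξ, η, η' > 0. Then for every 0 < ε < α there exist positive constants K₁, K₂ depending only on α and ε such that for all η ≥ η' > 0, ∫_0^{η+η'} f_α(ξ, η, η') dξ ≤ K₁ (η - η')^{-1+2α-ε} η^{1-2H+ε} + K₂ (η - η')^{-1+2α} η^{1-2H}. -/
open MeasureTheory

/-- Radial majorant of the two-pole kernel `|x| ^ (α - 1) * |x - 1| ^ (α - 1)`. -/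
noncomputable def poleMajorant (α t : ℝ) : ℝ :=
  if t ≤ 1 / 2 then 2 * t ^ (α - 1) else t ^ (2 * α - 2)

theorem poleMajorant_nonneg (α : ℝ) {t : ℝ} (ht : 0 ≤ t) : 0 ≤ poleMajorant α t := by
  unfold poleMajorant
  split_ifs <;> positivity

theorem rpow_mul_rpow_le_poleMajorant {α a b : ℝ} (h0 : 0 < α) (h1 : α < 1 / 2)
    (ha : 0 ≤ a) (hab : a ≤ b) (h : 1 ≤ a + b) :
    a ^ (α - 1) * b ^ (α - 1) ≤ poleMajorant α a := by
  unfold poleMajorant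
  have hb : 1 / 2 ≤ b := by linarith
  split_ifs with h2
  · rw [mul_comm]
    gcongr
    calc b ^ (α - 1) ≤ (1 / 2 : ℝ) ^ (α - 1) :=
          Real.rpow_le_rpow_of_nonpos (by norm_num) hb (by linarith)
      _ ≤ (1 / 2 : ℝ) ^ (-1 : ℝ) :=
          Real.rpow_le_rpow_of_exponent_ge (by norm_num) (by norm_num) (by linarith)
      _ = 2 := by rw [Real.rpow_neg_one]; norm_num
  · have ha' : 0 < a := by linarith
    calc a ^ (α - 1) * b ^ (α - 1) ≤ a ^ (α - 1) * a ^ (α - 1) := by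
          gcongr ?_ * ?_
          exact Real.rpow_le_rpow_of_nonpos ha' hab (by linarith)
      _ = a ^ (2 * α - 2) := by rw [← Real.rpow_add ha']; ring_nf

theorem rpow_mul_rpow_le_poleMajorant_add {α a b : ℝ} (h0 : 0 < α) (h1 : α < 1 / 2)
    (ha : 0 ≤ a) (hb : 0 ≤ b) (h : 1 ≤ a + b) :
    a ^ (α - 1) * b ^ (α - 1) ≤ poleMajorant α a + poleMajorant α b := by
  have hpa := poleMajorant_nonneg α ha
  have hpb := poleMajorant_nonneg α hb
  rcases le_total a b with hab | hab
  · linarith [rpow_mul_rpow_le_poleMajorant h0 h1 ha hab h]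
  · linarith [rpow_mul_rpow_le_poleMajorant h0 h1 hb hab (by linarith),
      mul_comm (a ^ (α - 1)) (b ^ (α - 1))]

theorem integrable_poleMajorant_abs {α : ℝ} (h0 : 0 < α) (h1 : α < 1 / 2) :
    Integrable fun x : ℝ => poleMajorant α |x| := by
  have key : IntegrableOn (poleMajorant α) (Set.Ioi 0) := by
    rw [← Set.Ioc_union_Ioi_eq_Ioi (show (0 : ℝ) ≤ 1 / 2 by norm_num)]
    refine IntegrableOn.union ?_ ?_
    · have h : IntegrableOn (fun t : ℝ => 2 * t ^ (α - 1)) (Set.Ioc 0 (1 / 2)) :=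
        ((intervalIntegrable_iff_integrableOn_Ioc_of_le (by norm_num)).1
          (intervalIntegral.intervalIntegrable_rpow' (by linarith))).const_mul 2
      refine h.congr_fun (fun t ht => ?_) measurableSet_Ioc
      simp only [poleMajorant]
      rw [if_pos ht.2]
    · have h : IntegrableOn (fun t : ℝ => t ^ (2 * α - 2)) (Set.Ioi (1 / 2)) :=
        integrableOn_Ioi_rpow_of_lt (by linarith) (by norm_num)
      refine h.congr_fun (fun t ht => ?_) measurableSet_Ioi
      simp only [poleMajorant]
      rw [if_neg (not_le.2 ht)]
  exact (integrable_fun_norm_addHaar (volume : Measure ℝ) (f := poleMajorant α)).2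
    (by simpa using key)

theorem rpow_abs_sub_mul_le {α η η' : ℝ} (h0 : 0 < α) (h1 : α < 1 / 2) (h : η' < η) (ξ : ℝ) :
    |ξ - η| ^ (α - 1) * |ξ - η'| ^ (α - 1) ≤
      (η - η') ^ (2 * α - 2) *
        (poleMajorant α |(ξ - η') / (η - η')| + poleMajorant α |(ξ - η') / (η - η') - 1|) := by
  have hd : 0 < η - η' := sub_pos.2 h
  set x := (ξ - η') / (η - η') with hx
  have e1 : ξ - η' = (η - η') * x := by rw [hx]; field_simp
  have e2 : ξ - η = (η - η') * (x - 1) := by linear_combination e1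
  have h2 : 1 ≤ |x| + |x - 1| := by
    have := abs_sub x (x - 1)
    have h3 : |x - (x - 1)| = 1 := by norm_num
    linarith
  rw [e1, e2, abs_mul, abs_mul, abs_of_pos hd, Real.mul_rpow hd.le (abs_nonneg _),
    Real.mul_rpow hd.le (abs_nonneg _)]
  calc (η - η') ^ (α - 1) * |x - 1| ^ (α - 1) * ((η - η') ^ (α - 1) * |x| ^ (α - 1))
      = ((η - η') ^ (α - 1) * (η - η') ^ (α - 1)) * (|x| ^ (α - 1) * |x - 1| ^ (α - 1)) := by ring
    _ = (η - η') ^ (2 * α - 2) * (|x| ^ (α - 1) * |x - 1| ^ (α - 1)) := by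
        rw [← Real.rpow_add hd]; ring_nf
    _ ≤ _ := by
        gcongr
        exact rpow_mul_rpow_le_poleMajorant_add h0 h1 (abs_nonneg _) (abs_nonneg _) h2

theorem not_intervalIntegrable_abs_rpow_mul_self {α s η : ℝ} (h1 : α < 1 / 2) (hs : 0 ≤ s)
    (hη : 0 < η) :
    ¬ IntervalIntegrable
      (fun ξ : ℝ => |ξ - η| ^ (α - 1) * |ξ - η| ^ (α - 1) * ξ ^ s) volume 0 (η + η) := by
  intro h
  have h2 := (h.mono_set (c := η) (d := η + η) (by
    rw [Set.uIcc_of_le (by linarith), Set.uIcc_of_le (by linarith)]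
    exact Set.Icc_subset_Icc_left hη.le)).comp_add_right η
  rw [sub_self, add_sub_cancel_right, intervalIntegrable_iff_integrableOn_Ioo_of_le hη.le] at h2
  have h3 : IntegrableOn (fun t : ℝ => t ^ (2 * α - 2)) (Set.Ioo 0 η) := by
    refine Integrable.mono' (h2.const_mul (η ^ s)⁻¹)
      (by fun_prop) ?_
    refine (ae_restrict_mem measurableSet_Ioo).mono fun t ht => ?_
    have ht0 : 0 < t := ht.1
    rw [Real.norm_of_nonneg (by positivity), add_sub_cancel_right, abs_of_pos ht0,
      ← Real.rpow_add ht0, show α - 1 + (α - 1) = 2 * α - 2 by ring]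
    have h4 : η ^ s ≤ (t + η) ^ s := Real.rpow_le_rpow hη.le (by linarith) hs
    have h5 : 0 < η ^ s := by positivity
    rw [mul_left_comm]
    refine le_mul_of_one_le_right (by positivity) ?_
    rw [inv_mul_eq_div, one_le_div h5]
    exact h4
  rw [intervalIntegral.integrableOn_Ioo_rpow_iff hη] at h3
  linarith

theorem integral_abs_rpow_mul_le {α s η η' : ℝ} (h0 : 0 < α) (h1 : α < 1 / 2)
    (hs0 : 0 ≤ s) (hs1 : s ≤ 1) (hη' : 0 < η') (h : η' < η) :
    (∫ ξ in (0 : ℝ)..(η + η'), |ξ - η| ^ (α - 1) * |ξ - η'| ^ (α - 1) * ξ ^ s) ≤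
      2 * (∫ x : ℝ, (poleMajorant α |x| + poleMajorant α |x - 1|)) *
        (η - η') ^ (-1 + 2 * α) * η ^ s := by
  have hη : 0 < η := hη'.trans h
  have hd : 0 < η - η' := sub_pos.2 h
  set Φ : ℝ → ℝ := fun x => poleMajorant α |x| + poleMajorant α |x - 1| with hΦ
  have hΦ0 : ∀ x, 0 ≤ Φ x := fun x =>
    add_nonneg (poleMajorant_nonneg α (abs_nonneg _)) (poleMajorant_nonneg α (abs_nonneg _))
  have hΦi : Integrable Φ :=
    (integrable_poleMajorant_abs h0 h1).add ((integrable_poleMajorant_abs h0 h1).comp_sub_right 1)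
  have hΨi : Integrable fun ξ : ℝ => Φ ((ξ - η') / (η - η')) :=
    (hΦi.comp_div hd.ne').comp_sub_right η'
  have hΨ : ∫ ξ : ℝ, Φ ((ξ - η') / (η - η')) = (η - η') * ∫ x, Φ x := by
    rw [integral_sub_right_eq_self (fun ξ => Φ (ξ / (η - η'))) η', Measure.integral_comp_div,
      abs_of_pos hd, smul_eq_mul]
  set c := (η - η') ^ (2 * α - 2) * (2 * η ^ s) with hc
  have hc0 : 0 ≤ c := by positivity
  rw [intervalIntegral.integral_of_le (by linarith)]
  calc ∫ ξ in Set.Ioc 0 (η + η'), |ξ - η| ^ (α - 1) * |ξ - η'| ^ (α - 1) * ξ ^ s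
      ≤ ∫ ξ in Set.Ioc 0 (η + η'), c * Φ ((ξ - η') / (η - η')) := by
        refine integral_mono_of_nonneg ?_ (hΨi.const_mul c).integrableOn ?_
        · refine (ae_restrict_mem measurableSet_Ioc).mono fun ξ hξ => ?_
          have := hξ.1
          simp only [Pi.zero_apply]
          positivity
        · refine (ae_restrict_mem measurableSet_Ioc).mono fun ξ hξ => ?_
          have hξ0 : 0 < ξ := hξ.1
          have hpow : ξ ^ s ≤ 2 * η ^ s := by
            calc ξ ^ s ≤ (2 * η) ^ s := Real.rpow_le_rpow hξ0.le (by linarith [hξ.2]) hs0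
              _ = 2 ^ s * η ^ s := Real.mul_rpow (by norm_num) hη.le
              _ ≤ 2 * η ^ s := by
                  gcongr
                  simpa using Real.rpow_le_rpow_of_exponent_le (one_le_two (α := ℝ)) hs1
          have hk := rpow_abs_sub_mul_le h0 h1 h ξ
          calc |ξ - η| ^ (α - 1) * |ξ - η'| ^ (α - 1) * ξ ^ s
              ≤ ((η - η') ^ (2 * α - 2) * Φ ((ξ - η') / (η - η'))) * (2 * η ^ s) :=
                mul_le_mul hk hpow (by positivity) (mul_nonneg (by positivity) (hΦ0 _))
            _ = c * Φ ((ξ - η') / (η - η')) := by rw [hc]; ring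
    _ ≤ ∫ ξ, c * Φ ((ξ - η') / (η - η')) :=
        setIntegral_le_integral (hΨi.const_mul c)
          (Filter.Eventually.of_forall fun ξ => mul_nonneg hc0 (hΦ0 _))
    _ = c * ((η - η') * ∫ x, Φ x) := by rw [integral_const_mul, hΨ]
    _ = 2 * (∫ x, Φ x) * (η - η') ^ (-1 + 2 * α) * η ^ s := by
        rw [show -1 + 2 * α = (2 * α - 2) + 1 by ring, Real.rpow_add_one hd.ne', hc]
        ring

/-- Bound for `∫_0^{η+η'} f_α(ξ,η,η') dξ` with constants depending only on `α` and `ε`. -/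
theorem fxi_bound_inner (α ε : ℝ) (hα : α ∈ Set.Ioo (0:ℝ) (1/2)) (hε : ε ∈ Set.Ioo (0:ℝ) α) :
    ∃ K₁ K₂ : ℝ, 0 < K₁ ∧ 0 < K₂ ∧
      ∀ H ∈ Set.Ioo (0:ℝ) (1/2), ∀ η η' : ℝ, 0 < η' → η' ≤ η →
        (∫ ξ in (0:ℝ)..(η + η'), |ξ - η| ^ (α - 1) * |ξ - η'| ^ (α - 1) * ξ ^ (1 - 2*H))
          ≤ K₁ * (η - η') ^ (-1 + 2*α - ε) * η ^ (1 - 2*H + ε)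
            + K₂ * (η - η') ^ (-1 + 2*α) * η ^ (1 - 2*H) := by
  obtain ⟨h0, h1⟩ := hα
  set C := ∫ x : ℝ, (poleMajorant α |x| + poleMajorant α |x - 1|) with hC
  have hC0 : 0 ≤ C := integral_nonneg fun x =>
    add_nonneg (poleMajorant_nonneg α (abs_nonneg _)) (poleMajorant_nonneg α (abs_nonneg _))
  refine ⟨1, 2 * C + 1, one_pos, by positivity, fun H hH η η' hη' hle => ?_⟩
  obtain ⟨hH0, hH1⟩ := hH
  have hη : 0 < η := hη'.trans_le hle
  have hd : 0 ≤ η - η' := sub_nonneg.2 hle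
  rcases hle.eq_or_lt with rfl | hlt
  · rw [intervalIntegral.integral_undef
      (not_intervalIntegrable_abs_rpow_mul_self h1 (by linarith) hη)]
    positivity
  · have hb := integral_abs_rpow_mul_le h0 h1 (s := 1 - 2 * H) (by linarith) (by linarith) hη' hlt
    have hA : 0 ≤ 1 * (η - η') ^ (-1 + 2 * α - ε) * η ^ (1 - 2 * H + ε) := by positivity
    have hB : 0 ≤ (η - η') ^ (-1 + 2 * α) * η ^ (1 - 2 * H) := by positivity
    rw [← hC] at hb
    linarith
end

section
/- Let H ∈ (0, 1/2) and α ∈ (0, H), and define f_α(ξ, η, η') = |ξ-η|^{α-1} |ξ-η'|^{α-1} ξ^{1-2H} for ξ, η, η' > 0. Then there exist positive constants K₃, K₄ depending only on α and H such that for all η ≥ η' > 0, ∫_{η+η'}^{∞} f_α(ξ, η, η') dξ ≤ K₃ (η')^{2α-2H} + K₄ η^{1-2H} (η')^{-1+2α}. (One may take K₃ = (2H-2α)^{-1} and K₄ = (1-2α)^{-1}.) -/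
open MeasureTheory

theorem integrableOn_Ioi_add_sub_rpow {a c r : ℝ} (hr : r < -1) (hc : 0 < c) :
    IntegrableOn (fun x : ℝ => (x - a) ^ r) (Set.Ioi (a + c)) := by
  simpa only [sub_eq_add_neg] using
    integrableOn_add_rpow_Ioi_of_lt (m := -a) (c := a + c) hr (by linarith)

theorem integral_Ioi_add_sub_rpow {a c r : ℝ} (hr : r < -1) (hc : 0 < c) :
    ∫ x in Set.Ioi (a + c), (x - a) ^ r = -c ^ (r + 1) / (r + 1) := by
  have h := (measurePreserving_sub_right volume a).setIntegral_preimage_emb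
    (measurableEmbedding_subRight a) (fun x : ℝ => x ^ r) (Set.Ioi c)
  have hs : (fun x : ℝ => x - a) ⁻¹' Set.Ioi c = Set.Ioi (a + c) := by
    rw [Set.preimage_sub_const_Ioi, add_comm]
  rw [hs, integral_Ioi_rpow_of_lt hr hc] at h
  exact h

/-- Pointwise bound of the integrand by a sum of two shifted powers. -/
theorem abs_sub_rpow_mul_abs_sub_rpow_mul_rpow_le {a s x y z : ℝ} (ha : a ≤ 1) (hs : 0 ≤ s)
    (hs1 : s ≤ 1) (hz : 0 ≤ z) (hzy : z ≤ y) (hx : y < x) :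
    |x - y| ^ (a - 1) * |x - z| ^ (a - 1) * x ^ s
      ≤ (x - y) ^ (2 * a - 2 + s) + y ^ s * (x - y) ^ (2 * a - 2) := by
  have hxy : 0 < x - y := sub_pos.2 hx
  rw [abs_of_pos hxy, abs_of_pos (by linarith : 0 < x - z)]
  have h1 : (x - z) ^ (a - 1) ≤ (x - y) ^ (a - 1) :=
    Real.rpow_le_rpow_of_nonpos hxy (by linarith) (by linarith)
  have h2 : x ^ s ≤ (x - y) ^ s + y ^ s := by
    simpa using Real.rpow_add_le_add_rpow hxy.le (hz.trans hzy) hs hs1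
  have hx0 : 0 ≤ x := by linarith
  calc (x - y) ^ (a - 1) * (x - z) ^ (a - 1) * x ^ s
      ≤ (x - y) ^ (a - 1) * (x - y) ^ (a - 1) * ((x - y) ^ s + y ^ s) := by gcongr
    _ = (x - y) ^ (2 * a - 2) * ((x - y) ^ s + y ^ s) := by
        rw [← Real.rpow_add hxy]; ring_nf
    _ = (x - y) ^ (2 * a - 2 + s) + y ^ s * (x - y) ^ (2 * a - 2) := by
        rw [Real.rpow_add hxy]; ring

/-- Bound for `∫_{η+η'}^∞ f_α(ξ,η,η') dξ` with constants depending only on `α` and `H`. -/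
theorem fxi_bound_outer (H α : ℝ) (hH : H ∈ Set.Ioo (0:ℝ) (1/2)) (hα : α ∈ Set.Ioo (0:ℝ) H) :
    ∃ K₃ K₄ : ℝ, 0 < K₃ ∧ 0 < K₄ ∧
      ∀ η η' : ℝ, 0 < η' → η' ≤ η →
        (∫ ξ in Set.Ioi (η + η'), |ξ - η| ^ (α - 1) * |ξ - η'| ^ (α - 1) * ξ ^ (1 - 2*H))
          ≤ K₃ * η' ^ (2*α - 2*H) + K₄ * η ^ (1 - 2*H) * η' ^ (-1 + 2*α) := by
  obtain ⟨hH0, hH1⟩ := hH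
  obtain ⟨hα0, hαH⟩ := hα
  refine ⟨(2 * H - 2 * α)⁻¹, (1 - 2 * α)⁻¹, inv_pos.2 (by linarith), inv_pos.2 (by linarith),
    fun η η' hη' hle => ?_⟩
  have hr₁ : 2 * α - 2 + (1 - 2 * H) < -1 := by linarith
  have hr₂ : 2 * α - 2 < -1 := by linarith
  have hi₁ := integrableOn_Ioi_add_sub_rpow (a := η) hr₁ hη'
  have hi₂ := (integrableOn_Ioi_add_sub_rpow (a := η) hr₂ hη').const_mul (η ^ (1 - 2 * H))
  calc ∫ ξ in Set.Ioi (η + η'), |ξ - η| ^ (α - 1) * |ξ - η'| ^ (α - 1) * ξ ^ (1 - 2*H)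
      ≤ ∫ ξ in Set.Ioi (η + η'), ((ξ - η) ^ (2 * α - 2 + (1 - 2 * H))
          + η ^ (1 - 2 * H) * (ξ - η) ^ (2 * α - 2)) := by
        refine integral_mono_of_nonneg ?_ (hi₁.add hi₂) ?_ <;>
          filter_upwards [ae_restrict_mem measurableSet_Ioi] with ξ hξ <;>
          rw [Set.mem_Ioi] at hξ
        · have : 0 ≤ ξ := by linarith
          simp only [Pi.zero_apply]
          positivity
        · exact abs_sub_rpow_mul_abs_sub_rpow_mul_rpow_le (by linarith) (by linarith)
            (by linarith) hη'.le hle (by linarith)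
    _ = (2 * H - 2 * α)⁻¹ * η' ^ (2*α - 2*H)
          + (1 - 2 * α)⁻¹ * η ^ (1 - 2*H) * η' ^ (-1 + 2*α) := by
        rw [integral_add hi₁ hi₂, integral_const_mul, integral_Ioi_add_sub_rpow hr₁ hη',
          integral_Ioi_add_sub_rpow hr₂ hη',
          show 2 * α - 2 + (1 - 2 * H) + 1 = 2 * α - 2 * H by ring,
          show 2 * α - 2 + 1 = -1 + 2 * α by ring, neg_div, ← div_neg, neg_div, ← div_neg,
          show -(2 * α - 2 * H) = 2 * H - 2 * α by ring,
          show -(-1 + 2 * α) = 1 - 2 * α by ring]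
        ring
end

section
/- Let H ∈ (0, 1/2) and ε ∈ (0, 1/4), and define φ₁(x) = ∫_x^1 ((t-x)^{2H-1} - 1)((1-t)^{2H-1} - (1-t+x)^{2H-1}) dt. Then φ₁(x) ≥ 0 for x ∈ (0, ε], and there exists a constant C > 0 depending only on H and ε such that φ₁(x) ≤ C x^{2H} for all x ∈ (0, ε]. (One may take C = (2H)^{-1}((1-ε)/2)^{2H-1} + (1-2H)(2H)^{-1}((1-ε)/2)^{4H-2}.) -/
open MeasureTheory

/-- The increment of `y ↦ y ^ a` is at most linear in the step, uniformly in `y ∈ [1/2, 1]`. -/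
lemma rpow_sub_rpow_add_le {a x y : ℝ} (ha : -1 ≤ a) (hx : 0 ≤ x)
    (hy : 1 / 2 ≤ y) (hy' : y ≤ 1) : y ^ a - (y + x) ^ a ≤ 4 * x := by
  have hy0 : 0 < y := by linarith
  have h1 : y ^ a ≤ 2 := by
    calc y ^ a ≤ y ^ (-1 : ℝ) := Real.rpow_le_rpow_of_exponent_ge hy0 hy' ha
      _ = y⁻¹ := Real.rpow_neg_one y
      _ ≤ 2 := by rw [inv_le_comm₀ hy0 (by norm_num)]; linarith
  have hu : 0 ≤ x / y := by positivity
  have hux : x / y ≤ 2 * x := by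
    rw [div_le_iff₀ hy0]; nlinarith
  have h2 : 1 - x / y ≤ (1 + x / y) ^ a := by
    calc 1 - x / y ≤ (1 + x / y)⁻¹ := by
          rw [← one_div, le_div_iff₀ (by positivity)]
          nlinarith
      _ = (1 + x / y) ^ (-1 : ℝ) := (Real.rpow_neg_one _).symm
      _ ≤ (1 + x / y) ^ a := Real.rpow_le_rpow_of_exponent_le (by linarith) ha
  have h3 : (y + x) ^ a = y ^ a * (1 + x / y) ^ a := by
    rw [← Real.mul_rpow hy0.le (by positivity)]
    congr 1
    field_simp
  have h4 : 0 ≤ y ^ a := by positivity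
  rw [h3]
  nlinarith [mul_le_mul_of_nonneg_left h2 h4, mul_le_mul h1 hux hu (by norm_num)]

lemma phi1_integrand_nonneg {a x t : ℝ} (ha : a ≤ 0) (hx : 0 ≤ x) (ht : t ∈ Set.Ioo x 1) :
    0 ≤ ((t - x) ^ a - 1) * ((1 - t) ^ a - (1 - t + x) ^ a) := by
  obtain ⟨h1, h2⟩ := ht
  refine mul_nonneg (sub_nonneg.2 ?_) (sub_nonneg.2 ?_)
  · exact Real.one_le_rpow_of_pos_of_le_one_of_nonpos (by linarith) (by linarith) ha
  · exact Real.rpow_le_rpow_of_nonpos (by linarith) (by linarith) ha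

lemma phi1_integrand_le {a x t : ℝ} (ha : -1 ≤ a) (ha' : a ≤ 0) (hx : 0 ≤ x) (hx' : x ≤ 1 / 4)
    (ht : t ∈ Set.Ioo x 1) :
    ((t - x) ^ a - 1) * ((1 - t) ^ a - (1 - t + x) ^ a)
      ≤ 4 * (x * (t - x) ^ a + ((1 - t) ^ a - (1 - t + x) ^ a)) := by
  obtain ⟨h1, h2⟩ := ht
  have htx : 0 < t - x := by linarith
  have hf : 0 ≤ (t - x) ^ a - 1 :=
    sub_nonneg.2 (Real.one_le_rpow_of_pos_of_le_one_of_nonpos htx (by linarith) ha')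
  have hg : 0 ≤ (1 - t) ^ a - (1 - t + x) ^ a :=
    sub_nonneg.2 (Real.rpow_le_rpow_of_nonpos (by linarith) (by linarith) ha')
  have hp : 0 ≤ (t - x) ^ a := by positivity
  rcases le_total t (1 / 2) with h | h
  · have := rpow_sub_rpow_add_le ha hx (y := 1 - t) (by linarith) (by linarith)
    nlinarith [mul_le_mul_of_nonneg_left this hf]
  · have : (t - x) ^ a ≤ 4 := by
      calc (t - x) ^ a ≤ (t - x) ^ (-1 : ℝ) :=
            Real.rpow_le_rpow_of_exponent_ge htx (by linarith) ha
        _ = (t - x)⁻¹ := Real.rpow_neg_one _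
        _ ≤ 4 := by rw [inv_le_comm₀ htx (by norm_num)]; linarith
    nlinarith [mul_le_mul_of_nonneg_right this hg, mul_nonneg hx hp]

/-- Nonnegativity and the bound `φ₁(x) ≤ C x^{2H}` on `(0, ε]`. -/
theorem phi1_bound (H ε : ℝ) (hH : H ∈ Set.Ioo (0:ℝ) (1/2)) (hε : ε ∈ Set.Ioo (0:ℝ) (1/4)) :
    (∀ x ∈ Set.Ioc (0:ℝ) ε,
      0 ≤ ∫ t in x..1,
        ((t - x) ^ (2*H - 1) - 1) * ((1 - t) ^ (2*H - 1) - (1 - t + x) ^ (2*H - 1)))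
    ∧ ∃ C : ℝ, 0 < C ∧ ∀ x ∈ Set.Ioc (0:ℝ) ε,
      (∫ t in x..1,
        ((t - x) ^ (2*H - 1) - 1) * ((1 - t) ^ (2*H - 1) - (1 - t + x) ^ (2*H - 1)))
        ≤ C * x ^ (2*H) := by
  obtain ⟨hH0, hH1⟩ := hH
  obtain ⟨hε0, hε1⟩ := hε
  refine ⟨fun x hx => ?_, 4 / H, by positivity, fun x hx => ?_⟩
  · obtain ⟨hx0, hxε⟩ := hx
    rw [intervalIntegral.integral_of_le (by linarith), integral_Ioc_eq_integral_Ioo]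
    exact setIntegral_nonneg measurableSet_Ioo fun t ht =>
      phi1_integrand_nonneg (by linarith) hx0.le ht
  obtain ⟨hx0, hxε⟩ := hx
  have ha : -1 < 2 * H - 1 := by linarith
  have i0 (b c : ℝ) : IntervalIntegrable (fun t : ℝ => t ^ (2 * H - 1)) volume b c :=
    intervalIntegral.intervalIntegrable_rpow' ha
  have i1 : IntervalIntegrable (fun t : ℝ => (t - x) ^ (2 * H - 1)) volume x 1 := by
    simpa using (i0 0 (1 - x)).comp_sub_right x
  have i2 : IntervalIntegrable (fun t : ℝ => (1 - t) ^ (2 * H - 1)) volume x 1 := by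
    simpa using (i0 (1 - x) 0).comp_sub_left 1
  have i3 : IntervalIntegrable (fun t : ℝ => (1 - t + x) ^ (2 * H - 1)) volume x 1 := by
    have := (i0 1 x).comp_sub_left (1 + x)
    simpa [sub_add_eq_add_sub] using this
  have i4 := ((i1.const_mul x).add (i2.sub i3)).const_mul 4
  have e1 : ∫ t in x..1, (t - x) ^ (2 * H - 1) = (1 - x) ^ (2 * H) / (2 * H) := by
    rw [intervalIntegral.integral_comp_sub_right (fun t : ℝ => t ^ (2 * H - 1)),
      integral_rpow (Or.inl ha)]
    simp [Real.zero_rpow, hH0.ne']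
  have e2 : ∫ t in x..1, (1 - t) ^ (2 * H - 1) = (1 - x) ^ (2 * H) / (2 * H) := by
    rw [intervalIntegral.integral_comp_sub_left (fun t : ℝ => t ^ (2 * H - 1)),
      integral_rpow (Or.inl ha)]
    simp [Real.zero_rpow, hH0.ne']
  have e3 : ∫ t in x..1, (1 - t + x) ^ (2 * H - 1) = (1 - x ^ (2 * H)) / (2 * H) := by
    simp_rw [sub_add_eq_add_sub]
    rw [intervalIntegral.integral_comp_sub_left (fun t : ℝ => t ^ (2 * H - 1)),
      integral_rpow (Or.inl ha)]
    simp
  have hle : (1 - x) ^ (2 * H) ≤ 1 :=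
    Real.rpow_le_one (by linarith) (by linarith) (by linarith)
  have hxle : x ≤ x ^ (2 * H) := by
    simpa using Real.rpow_le_rpow_of_exponent_ge hx0 (by linarith) (by linarith : 2 * H ≤ 1)
  calc _ ≤ ∫ t in x..1, 4 * (x * (t - x) ^ (2 * H - 1)
            + ((1 - t) ^ (2 * H - 1) - (1 - t + x) ^ (2 * H - 1))) := by
        rw [intervalIntegrable_iff_integrableOn_Ioo_of_le (by linarith)] at i4
        rw [intervalIntegral.integral_of_le (by linarith), integral_Ioc_eq_integral_Ioo,
          intervalIntegral.integral_of_le (by linarith), integral_Ioc_eq_integral_Ioo]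
        refine integral_mono_of_nonneg ?_ i4 ?_
        · filter_upwards [ae_restrict_mem measurableSet_Ioo] with t ht
          exact phi1_integrand_nonneg (by linarith) hx0.le ht
        · filter_upwards [ae_restrict_mem measurableSet_Ioo] with t ht
          exact phi1_integrand_le ha.le (by linarith) hx0.le (by linarith) ht
    _ = 4 * (x * ((1 - x) ^ (2 * H) / (2 * H))
          + ((1 - x) ^ (2 * H) / (2 * H) - (1 - x ^ (2 * H)) / (2 * H))) := by
        rw [intervalIntegral.integral_const_mul,
          intervalIntegral.integral_add (i1.const_mul x) (i2.sub i3),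
          intervalIntegral.integral_const_mul, intervalIntegral.integral_sub i2 i3, e1, e2, e3]
    _ = 2 / H * (x * (1 - x) ^ (2 * H) + ((1 - x) ^ (2 * H) - 1 + x ^ (2 * H))) := by
        field_simp
        ring
    _ ≤ 2 / H * (2 * x ^ (2 * H)) := by
        gcongr
        nlinarith
    _ = 4 / H * x ^ (2 * H) := by ring
end

section
/- Let H ∈ (0, 1/2) and ε ∈ (0, 1/4), and define φ₃(x,u) = ∫_x^1 (sgn(u-t)|u-t|^{2H-1} - sgn(x+u-t)|x+u-t|^{2H-1}) dt. Then φ₃(x,u) = (2H)^{-1} ( |u-x|^{2H} - (1-u)^{2H} + (1-x-u)^{2H} - u^{2H} ), and there exists a constant C > 0 depending only on H and ε such that |φ₃(x,u)| ≤ C (x^{2H} + u^{2H} + |u-x|^{2H}) for all (x,u) ∈ (0,ε]². -/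
open MeasureTheory

/-- `s ↦ sgn(s)|s|^(p-1)` is interval integrable from `0` when `p > 0`. -/
theorem intervalIntegrable_sign_mul_abs_rpow_zero {p : ℝ} (hp : 0 < p) (y : ℝ) :
    IntervalIntegrable (fun s : ℝ => Real.sign s * |s| ^ (p - 1)) volume 0 y := by
  have of_nonneg : ∀ z : ℝ, 0 ≤ z →
      IntervalIntegrable (fun s : ℝ => Real.sign s * |s| ^ (p - 1)) volume 0 z := by
    intro z hz
    refine (intervalIntegral.intervalIntegrable_rpow' (r := p - 1) (by linarith)).congr ?_
    intro s hs
    rw [Set.uIoc_of_le hz] at hs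
    simp [Real.sign_of_pos hs.1, abs_of_pos hs.1]
  rcases le_total 0 y with hy | hy
  · exact of_nonneg y hy
  · have h := ((of_nonneg (-y) (by linarith)).comp_mul_left (c := -1)).neg
    convert h using 1
    · ext s
      simp [Real.sign_neg]
    · simp
    · simp

theorem intervalIntegrable_sign_mul_abs_rpow {p : ℝ} (hp : 0 < p) (a b : ℝ) :
    IntervalIntegrable (fun s : ℝ => Real.sign s * |s| ^ (p - 1)) volume a b :=
  (intervalIntegrable_sign_mul_abs_rpow_zero hp a).symm.trans
    (intervalIntegrable_sign_mul_abs_rpow_zero hp b)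

theorem hasDerivAt_abs_rpow_of_ne_zero {p s : ℝ} (hs : s ≠ 0) :
    HasDerivAt (fun s : ℝ => |s| ^ p) (p * (Real.sign s * |s| ^ (p - 1))) s := by
  have h := (hasDerivAt_abs hs).rpow_const (p := p) (Or.inl (abs_ne_zero.mpr hs))
  convert h using 1
  rcases hs.lt_or_gt with h0 | h0
  · simp [Real.sign_of_neg h0, h0]
  · simp [Real.sign_of_pos h0, h0]

theorem integral_sign_mul_abs_rpow {p : ℝ} (hp : 0 < p) (a b : ℝ) :
    ∫ s in a..b, Real.sign s * |s| ^ (p - 1) = p⁻¹ * (|b| ^ p - |a| ^ p) := by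
  have h := integral_eq_of_hasDerivAt_off_countable (fun s : ℝ => |s| ^ p)
    (fun s => p * (Real.sign s * |s| ^ (p - 1))) (a := a) (b := b)
    (Set.countable_singleton (0 : ℝ))
    (continuous_abs.rpow_const fun _ => Or.inr hp.le).continuousOn
    (fun s hs => hasDerivAt_abs_rpow_of_ne_zero hs.2)
    ((intervalIntegrable_sign_mul_abs_rpow hp a b).const_mul p)
  rw [intervalIntegral.integral_const_mul] at h
  rw [← h, inv_mul_cancel_left₀ hp.ne']

theorem intervalIntegrable_sign_sub_mul_abs_rpow {p : ℝ} (hp : 0 < p) (a b c : ℝ) :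
    IntervalIntegrable (fun t : ℝ => Real.sign (c - t) * |c - t| ^ (p - 1)) volume a b := by
  simpa using (intervalIntegrable_sign_mul_abs_rpow hp (c - a) (c - b)).comp_sub_left c

theorem integral_sign_sub_mul_abs_rpow {p : ℝ} (hp : 0 < p) (a b c : ℝ) :
    ∫ t in a..b, Real.sign (c - t) * |c - t| ^ (p - 1)
      = p⁻¹ * (|c - a| ^ p - |c - b| ^ p) := by
  rw [intervalIntegral.integral_comp_sub_left (fun s => Real.sign s * |s| ^ (p - 1)) c,
    integral_sign_mul_abs_rpow hp]

/-- Closed form and the bound `|φ₃(x,u)| ≤ C (x^{2H} + u^{2H} + |u-x|^{2H})` on `(0, ε]²`. -/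
theorem phi3_bound (H ε : ℝ) (hH : H ∈ Set.Ioo (0:ℝ) (1/2)) (hε : ε ∈ Set.Ioo (0:ℝ) (1/4)) :
    (∀ x ∈ Set.Ioc (0:ℝ) ε, ∀ u ∈ Set.Ioc (0:ℝ) ε,
      (∫ t in x..1, (Real.sign (u - t) * |u - t| ^ (2*H - 1)
          - Real.sign (x + u - t) * |x + u - t| ^ (2*H - 1)))
        = (2*H)⁻¹ * (|u - x| ^ (2*H) - (1 - u) ^ (2*H) + (1 - x - u) ^ (2*H) - u ^ (2*H)))
    ∧ ∃ C : ℝ, 0 < C ∧ ∀ x ∈ Set.Ioc (0:ℝ) ε, ∀ u ∈ Set.Ioc (0:ℝ) ε,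
      |∫ t in x..1, (Real.sign (u - t) * |u - t| ^ (2*H - 1)
          - Real.sign (x + u - t) * |x + u - t| ^ (2*H - 1))|
        ≤ C * (x ^ (2*H) + u ^ (2*H) + |u - x| ^ (2*H)) := by
  obtain ⟨hH0, hH1⟩ := hH
  obtain ⟨hε0, hε1⟩ := hε
  have hp : 0 < 2 * H := by linarith
  have closed_form : ∀ x ∈ Set.Ioc (0:ℝ) ε, ∀ u ∈ Set.Ioc (0:ℝ) ε,
      (∫ t in x..1, (Real.sign (u - t) * |u - t| ^ (2*H - 1)
          - Real.sign (x + u - t) * |x + u - t| ^ (2*H - 1)))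
        = (2*H)⁻¹ * (|u - x| ^ (2*H) - (1 - u) ^ (2*H) + (1 - x - u) ^ (2*H) - u ^ (2*H)) := by
    rintro x ⟨hx0, hx1⟩ u ⟨hu0, hu1⟩
    rw [intervalIntegral.integral_sub (intervalIntegrable_sign_sub_mul_abs_rpow hp _ _ _)
      (intervalIntegrable_sign_sub_mul_abs_rpow hp _ _ _),
      integral_sign_sub_mul_abs_rpow hp, integral_sign_sub_mul_abs_rpow hp,
      abs_of_neg (show u - 1 < 0 by linarith), abs_of_neg (show x + u - 1 < 0 by linarith),
      add_sub_cancel_left, abs_of_pos hu0, neg_sub, neg_sub, ← sub_sub]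
    ring
  refine ⟨closed_form, (2 * H)⁻¹, inv_pos.mpr hp, ?_⟩
  rintro x ⟨hx0, hx1⟩ u ⟨hu0, hu1⟩
  rw [closed_form x ⟨hx0, hx1⟩ u ⟨hu0, hu1⟩, abs_mul, abs_of_pos (inv_pos.mpr hp)]
  refine mul_le_mul_of_nonneg_left ?_ (inv_pos.mpr hp).le
  have subadd : (1 - u) ^ (2*H) ≤ (1 - x - u) ^ (2*H) + x ^ (2*H) := by
    have h := Real.rpow_add_le_add_rpow (show 0 ≤ 1 - x - u by linarith) hx0.le hp.le
      (show 2 * H ≤ 1 by linarith)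
    rwa [show 1 - x - u + x = 1 - u by ring] at h
  have mono : (1 - x - u) ^ (2*H) ≤ (1 - u) ^ (2*H) :=
    Real.rpow_le_rpow (by linarith) (by linarith) hp.le
  have hx := Real.rpow_nonneg hx0.le (2*H)
  have hu := Real.rpow_nonneg hu0.le (2*H)
  have hd := Real.rpow_nonneg (abs_nonneg (u - x)) (2*H)
  rw [abs_le]
  constructor <;> linarith
end

section
/- Let H ∈ (0, 1/2) and ε ∈ (0, 1/4), and define φ₅(x,u) = ∫_x^1 ( sgn(x+u-t)|x+u-t|^{2H-1}(1-t)^{2H-1} - sgn(u-t)|u-t|^{2H-1}(1-t+x)^{2H-1} ) dt. Then there exists a constant C > 0 depending only on H and ε such that |φ₅(x,u)| ≤ C (x^{2H} + u^{2H} + |u-x|^{2H}) for all (x,u) ∈ (0,ε]². -/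
open MeasureTheory

lemma integral_abs_rpow_sub_one_of_nonneg {a α β : ℝ} (ha : 0 < a) (hα : 0 ≤ α) (hβ : 0 ≤ β) :
    ∫ v in α..β, |v| ^ (a - 1) = (β ^ a - α ^ a) / a := by
  rw [intervalIntegral.integral_congr (g := fun v => v ^ (a - 1)), integral_rpow (by left; linarith)]
  · simp
  · intro v hv
    have : 0 ≤ v := (le_min hα hβ).trans hv.1
    simp [abs_of_nonneg this]

lemma intervalIntegrable_abs_rpow_sub_one {a : ℝ} (ha : 0 < a) (α β : ℝ) :
    IntervalIntegrable (fun v : ℝ => |v| ^ (a - 1)) volume α β := by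
  have hpos : ∀ b : ℝ, 0 ≤ b → IntervalIntegrable (fun v : ℝ => |v| ^ (a - 1)) volume 0 b := by
    intro b hb
    refine (intervalIntegral.intervalIntegrable_rpow' (r := a - 1) (by linarith)).congr ?_
    intro v hv
    rw [Set.uIoc_of_le hb] at hv
    simp [abs_of_pos hv.1]
  have h0 : ∀ b : ℝ, IntervalIntegrable (fun v : ℝ => |v| ^ (a - 1)) volume 0 b := by
    intro b
    rcases le_total 0 b with hb | hb
    · exact hpos b hb
    · simpa using (hpos (-b) (by linarith)).comp_mul_left (c := -1)
  exact (h0 α).symm.trans (h0 β)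

lemma intervalIntegrable_abs_sub_rpow {a : ℝ} (ha : 0 < a) (c α β : ℝ) :
    IntervalIntegrable (fun s : ℝ => |c - s| ^ (a - 1)) volume α β := by
  simpa using (intervalIntegrable_abs_rpow_sub_one ha (c - α) (c - β)).comp_sub_left c

lemma integral_abs_sub_rpow_of_le {a c α β : ℝ} (ha : 0 < a) (hα : α ≤ c) (hβ : β ≤ c) :
    ∫ s in α..β, |c - s| ^ (a - 1) = ((c - α) ^ a - (c - β) ^ a) / a := by
  rw [intervalIntegral.integral_comp_sub_left (fun v : ℝ => |v| ^ (a - 1)),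
    integral_abs_rpow_sub_one_of_nonneg ha (by linarith) (by linarith)]

lemma integral_abs_sub_rpow_le {a : ℝ} (ha : 0 < a) (c α β : ℝ) :
    ∫ s in α..β, |c - s| ^ (a - 1) ≤ (|c - α| ^ a + |c - β| ^ a) / a := by
  have h0 : ∀ b : ℝ, |∫ v in (0:ℝ)..b, |v| ^ (a - 1)| = |b| ^ a / a := by
    have hpos : ∀ b : ℝ, 0 ≤ b → ∫ v in (0:ℝ)..b, |v| ^ (a - 1) = b ^ a / a := fun b hb => by
      rw [integral_abs_rpow_sub_one_of_nonneg ha le_rfl hb, Real.zero_rpow ha.ne', sub_zero]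
    intro b
    rcases le_total 0 b with hb | hb
    · rw [hpos b hb, abs_of_nonneg hb, abs_of_nonneg (by positivity)]
    · have h := intervalIntegral.integral_comp_neg (a := b) (b := 0) (fun v : ℝ => |v| ^ (a - 1))
      simp only [abs_neg, neg_zero] at h
      have hb' : 0 ≤ -b := by linarith
      rw [intervalIntegral.integral_symm, h, hpos _ hb', abs_neg, abs_of_nonpos hb,
        abs_of_nonneg (by positivity)]
  rw [intervalIntegral.integral_comp_sub_left (fun v : ℝ => |v| ^ (a - 1)),
    ← intervalIntegral.integral_interval_sub_left (a := 0)
      (intervalIntegrable_abs_rpow_sub_one ha _ _) (intervalIntegrable_abs_rpow_sub_one ha _ _),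
    add_div, ← h0, ← h0]
  linarith [le_abs_self (∫ v in (0:ℝ)..(c - α), |v| ^ (a - 1)),
    neg_abs_le (∫ v in (0:ℝ)..(c - β), |v| ^ (a - 1))]

lemma abs_sign_mul_abs_rpow_le (v b : ℝ) : |Real.sign v * |v| ^ b| ≤ |v| ^ b := by
  rw [abs_mul, abs_of_nonneg (Real.rpow_nonneg (abs_nonneg v) b)]
  refine mul_le_of_le_one_left (by positivity) ?_
  rcases Real.sign_apply_eq v with h | h | h <;> simp [h]

lemma measurable_real_sign : Measurable Real.sign := by
  unfold Real.sign
  exact Measurable.ite measurableSet_Iio measurable_const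
    (Measurable.ite measurableSet_Ioi measurable_const measurable_const)

/-- The product `sgn(u - s) |u - s|^(a - 1) |c - s|^(a - 1)`, singular at `u` and at `c`. -/
noncomputable def singularProduct (a u c s : ℝ) : ℝ :=
  Real.sign (u - s) * |u - s| ^ (a - 1) * |c - s| ^ (a - 1)

lemma measurable_singularProduct (a u c : ℝ) : Measurable (singularProduct a u c) := by
  unfold singularProduct
  have h := measurable_real_sign.comp (measurable_const.sub measurable_id : Measurable fun s => u - s)
  exact (h.mul (by fun_prop)).mul (by fun_prop)

lemma abs_rpow_sub_one_le {a v : ℝ} (ha : a < 1) (hv : 1 / 4 ≤ |v|) :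
    |v| ^ (a - 1) ≤ (1 / 4 : ℝ) ^ (a - 1) :=
  Real.rpow_le_rpow_of_nonpos (by norm_num) hv (by linarith)

lemma abs_singularProduct_le_left {a u c s : ℝ} (ha : a < 1) (hs : 1 / 4 ≤ |c - s|) :
    |singularProduct a u c s| ≤ (1 / 4 : ℝ) ^ (a - 1) * |u - s| ^ (a - 1) := by
  rw [singularProduct, abs_mul, mul_comm, abs_of_nonneg (Real.rpow_nonneg (abs_nonneg (c - s)) _)]
  exact mul_le_mul (abs_rpow_sub_one_le ha hs) (abs_sign_mul_abs_rpow_le _ _) (abs_nonneg _)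
    (by positivity)

lemma abs_singularProduct_le_right {a u c s : ℝ} (ha : a < 1) (hs : 1 / 4 ≤ |u - s|) :
    |singularProduct a u c s| ≤ (1 / 4 : ℝ) ^ (a - 1) * |c - s| ^ (a - 1) := by
  rw [singularProduct, abs_mul, abs_of_nonneg (Real.rpow_nonneg (abs_nonneg (c - s)) _)]
  exact mul_le_mul_of_nonneg_right
    ((abs_sign_mul_abs_rpow_le _ _).trans (abs_rpow_sub_one_le ha hs)) (by positivity)

lemma intervalIntegrable_singularProduct {a u c : ℝ} (ha : 0 < a) (ha1 : a < 1)
    (hu : u ≤ 1 / 4) (hc : 3 / 4 ≤ c) (α β : ℝ) :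
    IntervalIntegrable (singularProduct a u c) volume α β := by
  have hg := ((intervalIntegrable_abs_sub_rpow ha u α β).add
    (intervalIntegrable_abs_sub_rpow ha c α β)).const_mul ((1 / 4 : ℝ) ^ (a - 1))
  refine hg.mono_fun (measurable_singularProduct a u c).aestronglyMeasurable
    (Filter.Eventually.of_forall fun s => ?_)
  have hK : 0 ≤ (1 / 4 : ℝ) ^ (a - 1) := by positivity
  have hp := mul_nonneg hK (Real.rpow_nonneg (abs_nonneg (u - s)) (a - 1))
  have hq := mul_nonneg hK (Real.rpow_nonneg (abs_nonneg (c - s)) (a - 1))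
  refine le_trans ?_ (Real.le_norm_self _)
  simp only [Real.norm_eq_abs, mul_add]
  rcases le_total s (1 / 2) with hs | hs
  · linarith [abs_singularProduct_le_left (u := u) ha1
      (show 1 / 4 ≤ |c - s| from le_trans (by linarith) (le_abs_self _))]
  · linarith [abs_singularProduct_le_right (c := c) ha1
      (show 1 / 4 ≤ |u - s| from le_trans (by linarith) (neg_le_abs _))]

lemma rpow_sub_one_sub_rpow_sub_one_le {a y z : ℝ} (ha : 0 ≤ a) (hy : 0 < y)
    (hyz : y ≤ z) : y ^ (a - 1) - z ^ (a - 1) ≤ y ^ (a - 1) * ((z - y) / z) := by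
  have hz : 0 < z := hy.trans_le hyz
  have h1 : y / z ≤ (y / z) ^ (1 - a) :=
    Real.self_le_rpow_of_le_one (by positivity) ((div_le_one hz).2 hyz) (by linarith)
  have h2 : z ^ (a - 1) = y ^ (a - 1) * (y / z) ^ (1 - a) := by
    rw [Real.div_rpow hy.le hz.le, show a - 1 = -(1 - a) by ring, Real.rpow_neg hz.le,
      Real.rpow_neg hy.le]
    have := (Real.rpow_pos_of_pos hy (1 - a)).ne'
    field_simp
  have h3 : (z - y) / z = 1 - y / z := by field_simp
  rw [h2, h3, ← mul_one_sub]
  exact mul_le_mul_of_nonneg_left (by linarith) (by positivity)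

lemma abs_singularProduct_sub_le (a u c d s : ℝ) :
    |singularProduct a u c s - singularProduct a u d s|
      ≤ |u - s| ^ (a - 1) * |(|c - s| ^ (a - 1) - |d - s| ^ (a - 1))| := by
  rw [singularProduct, singularProduct, ← mul_sub, abs_mul]
  exact mul_le_mul_of_nonneg_right (abs_sign_mul_abs_rpow_le _ _) (abs_nonneg _)

section pieces

variable {a x u : ℝ}

lemma abs_integral_singularProduct_initial_le (ha : 0 < a) (ha1 : a < 1)
    (hx : 0 < x) (hx4 : x < 1 / 4) (hu : 0 < u) :
    |∫ s in (0:ℝ)..x, singularProduct a u (1 - x) s|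
      ≤ (1 / 4 : ℝ) ^ (a - 1) * ((u ^ a + |u - x| ^ a) / a) := by
  have h := intervalIntegral.norm_integral_le_of_norm_le hx.le (μ := volume)
    (f := singularProduct a u (1 - x)) (g := fun s => (1 / 4 : ℝ) ^ (a - 1) * |u - s| ^ (a - 1))
    (Filter.Eventually.of_forall fun s hs => abs_singularProduct_le_left ha1
      (le_trans (by linarith [hs.2]) (le_abs_self _)))
    ((intervalIntegrable_abs_sub_rpow ha u 0 x).const_mul _)
  rw [intervalIntegral.integral_const_mul] at h
  refine h.trans (mul_le_mul_of_nonneg_left ?_ (by positivity))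
  simpa [abs_of_pos hu] using integral_abs_sub_rpow_le ha u 0 x

lemma abs_integral_singularProduct_sub_left_le (ha : 0 < a) (ha1 : a < 1)
    (hx : 0 < x) (hx4 : x < 1 / 4) (hu : 0 < u) (hu4 : u < 1 / 4) :
    |∫ s in x..(1 / 2), (singularProduct a u (1 - x) s - singularProduct a u (1 + x) s)|
      ≤ (1 / 4 : ℝ) ^ (a - 1) * (8 * x ^ a / a) := by
  have h := intervalIntegral.norm_integral_le_of_norm_le (show x ≤ 1 / 2 by linarith) (μ := volume)
    (f := fun s => singularProduct a u (1 - x) s - singularProduct a u (1 + x) s)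
    (g := fun s => ((1 / 4 : ℝ) ^ (a - 1) * (4 * x)) * |u - s| ^ (a - 1))
    (Filter.Eventually.of_forall fun s hs => by
      have hy : 1 / 4 ≤ 1 - x - s := by linarith [hs.2]
      have hz : 1 / 2 ≤ 1 + x - s := by linarith [hs.2]
      have hyz : 1 - x - s ≤ 1 + x - s := by linarith
      have hmono : (1 + x - s) ^ (a - 1) ≤ (1 - x - s) ^ (a - 1) :=
        Real.rpow_le_rpow_of_nonpos (by linarith) hyz (by linarith)
      have hsub := rpow_sub_one_sub_rpow_sub_one_le ha.le (by linarith) hyz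
      have hK : (1 - x - s) ^ (a - 1) ≤ (1 / 4 : ℝ) ^ (a - 1) :=
        Real.rpow_le_rpow_of_nonpos (by norm_num) hy (by linarith)
      have hq : (1 + x - s - (1 - x - s)) / (1 + x - s) ≤ 4 * x := by
        rw [div_le_iff₀ (by linarith)]
        nlinarith
      refine (abs_singularProduct_sub_le _ _ _ _ _).trans ?_
      rw [mul_comm]
      refine mul_le_mul_of_nonneg_right ?_ (by positivity)
      rw [abs_of_pos (by linarith : 0 < 1 - x - s), abs_of_pos (by linarith : 0 < 1 + x - s),
        abs_of_nonneg (by linarith)]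
      exact hsub.trans (mul_le_mul hK hq (div_nonneg (by linarith) (by linarith)) (by positivity)))
    ((intervalIntegrable_abs_sub_rpow ha u _ _).const_mul _)
  rw [intervalIntegral.integral_const_mul] at h
  have h1 : |u - x| ^ a ≤ 1 :=
    Real.rpow_le_one (abs_nonneg _) (abs_le.2 ⟨by linarith, by linarith⟩) ha.le
  have h2 : |u - 1 / 2| ^ a ≤ 1 :=
    Real.rpow_le_one (abs_nonneg _) (abs_le.2 ⟨by linarith, by linarith⟩) ha.le
  have h3 : ∫ s in x..(1 / 2), |u - s| ^ (a - 1) ≤ 2 / a :=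
    (integral_abs_sub_rpow_le ha u x (1 / 2)).trans (by gcongr; linarith)
  have h4 : x ≤ x ^ a := Real.self_le_rpow_of_le_one hx.le (by linarith) ha1.le
  calc _ ≤ _ := h
    _ ≤ ((1 / 4 : ℝ) ^ (a - 1) * (4 * x ^ a)) * (2 / a) :=
      (mul_le_mul_of_nonneg_left h3 (by positivity)).trans (by gcongr)
    _ = _ := by ring

lemma abs_integral_singularProduct_sub_right_le (ha : 0 < a) (ha1 : a < 1)
    (hx : 0 < x) (hx4 : x < 1 / 4) (hu4 : u < 1 / 4) :
    |∫ s in (1 / 2)..(1 - x), (singularProduct a u (1 - x) s - singularProduct a u (1 + x) s)|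
      ≤ (1 / 4 : ℝ) ^ (a - 1) * ((2 * x) ^ a / a) := by
  have hi := intervalIntegrable_abs_sub_rpow ha (1 - x) (1 / 2) (1 - x)
  have hj := intervalIntegrable_abs_sub_rpow ha (1 + x) (1 / 2) (1 - x)
  have hne : ∀ᵐ s : ℝ, s ≠ 1 - x := by simp [ae_iff]
  have h := intervalIntegral.norm_integral_le_of_norm_le (show 1 / 2 ≤ 1 - x by linarith)
    (μ := volume)
    (f := fun s => singularProduct a u (1 - x) s - singularProduct a u (1 + x) s)
    (g := fun s => (1 / 4 : ℝ) ^ (a - 1) * (|1 - x - s| ^ (a - 1) - |1 + x - s| ^ (a - 1)))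
    (by
      filter_upwards [hne] with s hs1 hs
      have hlt : s < 1 - x := lt_of_le_of_ne hs.2 hs1
      have hmono : |1 + x - s| ^ (a - 1) ≤ |1 - x - s| ^ (a - 1) := by
        rw [abs_of_pos (by linarith : 0 < 1 - x - s), abs_of_pos (by linarith : 0 < 1 + x - s)]
        exact Real.rpow_le_rpow_of_nonpos (by linarith) (by linarith) (by linarith)
      refine (abs_singularProduct_sub_le _ _ _ _ _).trans ?_
      rw [abs_of_nonneg (sub_nonneg.2 hmono)]
      exact mul_le_mul_of_nonneg_right (abs_rpow_sub_one_le ha1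
        (le_trans (by linarith [hs.1]) (neg_le_abs _))) (sub_nonneg.2 hmono))
    ((hi.sub hj).const_mul _)
  rw [intervalIntegral.integral_const_mul, intervalIntegral.integral_sub hi hj,
    integral_abs_sub_rpow_of_le ha (by linarith) le_rfl,
    integral_abs_sub_rpow_of_le ha (by linarith) (by linarith), ← sub_div] at h
  refine h.trans ?_
  have hmono : (1 - x - 1 / 2) ^ a ≤ (1 + x - 1 / 2) ^ a :=
    Real.rpow_le_rpow (by linarith) (by linarith) ha.le
  gcongr
  rw [sub_self, Real.zero_rpow ha.ne', show 1 + x - (1 - x) = 2 * x by ring]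
  linarith

lemma abs_integral_singularProduct_final_le (ha : 0 < a) (ha1 : a < 1)
    (hx : 0 < x) (hx4 : x < 1 / 4) (hu4 : u < 1 / 4) :
    |∫ s in (1 - x)..1, singularProduct a u (1 + x) s|
      ≤ (1 / 4 : ℝ) ^ (a - 1) * ((2 * x) ^ a / a) := by
  have h := intervalIntegral.norm_integral_le_of_norm_le (show 1 - x ≤ 1 by linarith) (μ := volume)
    (f := singularProduct a u (1 + x))
    (g := fun s => (1 / 4 : ℝ) ^ (a - 1) * |1 + x - s| ^ (a - 1))
    (Filter.Eventually.of_forall fun s hs => abs_singularProduct_le_right ha1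
      (le_trans (by linarith [hs.1]) (neg_le_abs _)))
    ((intervalIntegrable_abs_sub_rpow ha (1 + x) _ _).const_mul _)
  rw [intervalIntegral.integral_const_mul,
    integral_abs_sub_rpow_of_le ha (by linarith) (by linarith)] at h
  refine h.trans ?_
  gcongr
  have : 0 ≤ x ^ a := by positivity
  rw [show 1 + x - (1 - x) = 2 * x by ring, show 1 + x - 1 = x by ring]
  linarith

lemma integral_singularProduct_shift_sub_eq (ha : 0 < a) (ha1 : a < 1)
    (hx : 0 < x) (hx4 : x < 1 / 4) (hu4 : u < 1 / 4) :
    ∫ t in x..1, (Real.sign (x + u - t) * |x + u - t| ^ (a - 1) * (1 - t) ^ (a - 1)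
        - Real.sign (u - t) * |u - t| ^ (a - 1) * (1 - t + x) ^ (a - 1))
      = (∫ s in (0:ℝ)..x, singularProduct a u (1 - x) s)
        + (∫ s in x..(1 / 2), (singularProduct a u (1 - x) s - singularProduct a u (1 + x) s))
        + (∫ s in (1 / 2)..(1 - x),
            (singularProduct a u (1 - x) s - singularProduct a u (1 + x) s))
        - ∫ s in (1 - x)..1, singularProduct a u (1 + x) s := by
  have h₁ := fun α β => intervalIntegrable_singularProduct ha ha1 hu4.le
    (show 3 / 4 ≤ 1 - x by linarith) α β
  have h₂ := fun α β => intervalIntegrable_singularProduct ha ha1 hu4.le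
    (show 3 / 4 ≤ 1 + x by linarith) α β
  have hshift : IntervalIntegrable (fun t => singularProduct a u (1 - x) (t - x)) volume x 1 := by
    simpa using (h₁ 0 (1 - x)).comp_sub_right x
  rw [intervalIntegral.integral_congr (g := fun t =>
      singularProduct a u (1 - x) (t - x) - singularProduct a u (1 + x) t)]
  · rw [intervalIntegral.integral_sub hshift (h₂ _ _),
      intervalIntegral.integral_comp_sub_right (singularProduct a u (1 - x)), sub_self,
      intervalIntegral.integral_sub (h₁ _ _) (h₂ _ _),
      intervalIntegral.integral_sub (h₁ _ _) (h₂ _ _),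
      ← intervalIntegral.integral_add_adjacent_intervals (h₁ 0 x) (h₁ x (1 - x)),
      ← intervalIntegral.integral_add_adjacent_intervals (h₁ x (1 / 2)) (h₁ (1 / 2) (1 - x)),
      ← intervalIntegral.integral_add_adjacent_intervals (h₂ x (1 / 2)) (h₂ (1 / 2) 1),
      ← intervalIntegral.integral_add_adjacent_intervals (h₂ (1 / 2) (1 - x)) (h₂ (1 - x) 1)]
    ring
  · intro t ht
    rw [Set.uIcc_of_le (by linarith)] at ht
    simp only [singularProduct]
    rw [show u - (t - x) = x + u - t by ring, show 1 - x - (t - x) = 1 - t by ring,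
      show 1 + x - t = 1 - t + x by ring, abs_of_nonneg (by linarith [ht.2] : 0 ≤ 1 - t),
      abs_of_nonneg (by linarith [ht.2] : 0 ≤ 1 - t + x)]

end pieces

/-- The bound `|φ₅(x,u)| ≤ C (x^{2H} + u^{2H} + |u-x|^{2H})` on `(0, ε]²`. -/
theorem phi5_bound (H ε : ℝ) (hH : H ∈ Set.Ioo (0:ℝ) (1/2)) (hε : ε ∈ Set.Ioo (0:ℝ) (1/4)) :
    ∃ C : ℝ, 0 < C ∧ ∀ x ∈ Set.Ioc (0:ℝ) ε, ∀ u ∈ Set.Ioc (0:ℝ) ε,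
      |∫ t in x..1,
          (Real.sign (x + u - t) * |x + u - t| ^ (2*H - 1) * (1 - t) ^ (2*H - 1)
            - Real.sign (u - t) * |u - t| ^ (2*H - 1) * (1 - t + x) ^ (2*H - 1))|
        ≤ C * (x ^ (2*H) + u ^ (2*H) + |u - x| ^ (2*H)) := by
  obtain ⟨hH0, hH1⟩ := hH
  have ha : 0 < 2 * H := by linarith
  have ha1 : 2 * H < 1 := by linarith
  refine ⟨(1 / 4 : ℝ) ^ (2 * H - 1) / (2 * H) * 12, by positivity, ?_⟩
  rintro x ⟨hx, hxε⟩ u ⟨hu, huε⟩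
  have hx4 : x < 1 / 4 := hxε.trans_lt hε.2
  have hu4 : u < 1 / 4 := huε.trans_lt hε.2
  rw [integral_singularProduct_shift_sub_eq ha ha1 hx hx4 hu4]
  refine (abs_sub _ _).trans ((add_le_add (abs_add_three _ _ _) le_rfl).trans
    ((add_le_add (add_le_add (add_le_add
      (abs_integral_singularProduct_initial_le ha ha1 hx hx4 hu)
      (abs_integral_singularProduct_sub_left_le ha ha1 hx hx4 hu hu4))
      (abs_integral_singularProduct_sub_right_le ha ha1 hx hx4 hu4))
      (abs_integral_singularProduct_final_le ha ha1 hx hx4 hu4)).trans ?_))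
  have h2 : (2 * x) ^ (2 * H) ≤ 2 * x ^ (2 * H) := by
    rw [Real.mul_rpow (by norm_num) hx.le]
    gcongr
    exact Real.rpow_le_self_of_one_le (by norm_num) ha1.le
  calc _ = (1 / 4 : ℝ) ^ (2 * H - 1) / (2 * H) *
        (u ^ (2 * H) + |u - x| ^ (2 * H) + 8 * x ^ (2 * H) + 2 * (2 * x) ^ (2 * H)) := by ring
    _ ≤ (1 / 4 : ℝ) ^ (2 * H - 1) / (2 * H) *
        (12 * (x ^ (2 * H) + u ^ (2 * H) + |u - x| ^ (2 * H))) := by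
      gcongr
      have : 0 ≤ u ^ (2 * H) := by positivity
      have : 0 ≤ |u - x| ^ (2 * H) := by positivity
      linarith
    _ = _ := by ring
end

section
/- Let H ∈ (0, 1/2). Then 2 ∫_0^∞ ∫_0^∞ ∫_0^∞ e^{-(a+2u)} b^{2H-1} ( (a+b)^{2H-1} - (a+b+2u)^{2H-1} ) du da db = Γ(2-4H) Γ(2H) Γ(4H) / Γ(1-2H), where Γ is the Gamma function. -/
open MeasureTheory

/-- The Gamma integral with rate `r`, as a Lebesgue integral. -/
theorem lintegral_rpow_mul_exp_neg_mul_Ioi {q r : ℝ} (hq : 0 < q) (hr : 0 < r) :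
    ∫⁻ t in Set.Ioi (0:ℝ), ENNReal.ofReal (t ^ (q - 1) * Real.exp (-(r * t)))
      = ENNReal.ofReal ((1 / r) ^ q * Real.Gamma q) := by
  have h := Real.integral_rpow_mul_exp_neg_mul_Ioi hq hr
  have hpos : 0 < (1 / r) ^ q * Real.Gamma q := by
    have := Real.Gamma_pos_of_pos hq
    positivity
  have hint : IntegrableOn (fun t : ℝ => t ^ (q - 1) * Real.exp (-(r * t))) (Set.Ioi 0) := by
    by_contra hni
    rw [integral_undef hni] at h
    exact hpos.ne h
  rw [← h, ofReal_integral_eq_lintegral_ofReal hint]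
  filter_upwards [ae_restrict_mem measurableSet_Ioi] with t ht
  have : (0:ℝ) < t := ht
  positivity

theorem lintegral_rpow_mul_exp_neg_mul_sub_Ioi {q r s : ℝ} (hq : 0 < q) (hr : 0 < r)
    (hrs : r ≤ s) :
    ∫⁻ t in Set.Ioi (0:ℝ),
        ENNReal.ofReal (t ^ (q - 1) * (Real.exp (-(r * t)) - Real.exp (-(s * t))))
      = ENNReal.ofReal ((1 / r) ^ q * Real.Gamma q - (1 / s) ^ q * Real.Gamma q) := by
  have hs : 0 < s := hr.trans_le hrs
  have hΓ := Real.Gamma_pos_of_pos hq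
  have e : ∀ t ∈ Set.Ioi (0:ℝ),
      ENNReal.ofReal (t ^ (q - 1) * (Real.exp (-(r * t)) - Real.exp (-(s * t))))
      = ENNReal.ofReal (t ^ (q - 1) * Real.exp (-(r * t)))
        - ENNReal.ofReal (t ^ (q - 1) * Real.exp (-(s * t))) := by
    intro t ht
    have ht : (0:ℝ) < t := ht
    rw [mul_sub, ENNReal.ofReal_sub _ (by positivity)]
  rw [setLIntegral_congr_fun measurableSet_Ioi e, lintegral_sub (by fun_prop),
    lintegral_rpow_mul_exp_neg_mul_Ioi hq hr, lintegral_rpow_mul_exp_neg_mul_Ioi hq hs,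
    ENNReal.ofReal_sub _ (by positivity)]
  · rw [lintegral_rpow_mul_exp_neg_mul_Ioi hq hs]
    exact ENNReal.ofReal_ne_top
  · filter_upwards [ae_restrict_mem measurableSet_Ioi] with t ht
    have ht : (0:ℝ) < t := ht
    gcongr

/-- The Beta integral in the form `∫ t ^ (1 - x) / (1 + t) ^ 2`. -/
theorem lintegral_rpow_div_one_add_sq {x : ℝ} (hx : 0 < x) (hx2 : x < 2) :
    ∫⁻ t in Set.Ioi (0:ℝ), ENNReal.ofReal (t ^ (1 - x) * (1 / (1 + t)) ^ 2)
      = ENNReal.ofReal (Real.Gamma (2 - x) * Real.Gamma x) := by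
  have h1 : ∀ t ∈ Set.Ioi (0:ℝ), ENNReal.ofReal (t ^ (1 - x) * (1 / (1 + t)) ^ 2)
      = ∫⁻ s in Set.Ioi (0:ℝ),
          ENNReal.ofReal (t ^ (1 - x) * (s * Real.exp (-((1 + t) * s)))) := by
    intro t ht
    have ht : (0:ℝ) < t := ht
    have h := lintegral_rpow_mul_exp_neg_mul_Ioi (q := 2) (r := 1 + t) two_pos (by linarith)
    have e : (2:ℝ) - 1 = 1 := by norm_num
    simp only [Real.Gamma_two, e, Real.rpow_one, mul_one, Real.rpow_two] at h
    simp only [ENNReal.ofReal_mul (Real.rpow_nonneg ht.le (1 - x))]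
    rw [lintegral_const_mul _ (by fun_prop), h]
  have h2 : ∀ s ∈ Set.Ioi (0:ℝ), ∫⁻ t in Set.Ioi (0:ℝ),
      ENNReal.ofReal (t ^ (1 - x) * (s * Real.exp (-((1 + t) * s))))
      = ENNReal.ofReal (Real.Gamma (2 - x)) *
          ENNReal.ofReal (s ^ (x - 1) * Real.exp (-(1 * s))) := by
    intro s hs
    have hs : (0:ℝ) < s := hs
    have h := lintegral_rpow_mul_exp_neg_mul_Ioi (q := 2 - x) (r := s) (by linarith) hs
    have e : ∀ t : ℝ, t ^ (1 - x) * (s * Real.exp (-((1 + t) * s)))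
        = (s * Real.exp (-s)) * (t ^ (2 - x - 1) * Real.exp (-(s * t))) := by
      intro t
      rw [show -((1 + t) * s) = -s + -(s * t) by ring, Real.exp_add,
        show 2 - x - 1 = 1 - x by ring]
      ring
    have hs' : 0 ≤ s * Real.exp (-s) := by positivity
    simp only [e, ENNReal.ofReal_mul hs']
    rw [lintegral_const_mul _ (by fun_prop), h, ← ENNReal.ofReal_mul hs',
      ← ENNReal.ofReal_mul (Real.Gamma_pos_of_pos (by linarith)).le]
    congr 1
    rw [one_div, Real.inv_rpow hs.le, ← Real.rpow_neg hs.le,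
      show x - 1 = 1 + -(2 - x) by ring, Real.rpow_add hs, Real.rpow_one, one_mul]
    ring
  rw [setLIntegral_congr_fun measurableSet_Ioi h1, lintegral_lintegral_swap
    (by fun_prop), setLIntegral_congr_fun measurableSet_Ioi h2,
    lintegral_const_mul _ (by fun_prop), lintegral_rpow_mul_exp_neg_mul_Ioi hx one_pos,
    ← ENNReal.ofReal_mul (Real.Gamma_pos_of_pos (by linarith)).le]
  simp

/-- A nonnegative function whose Lebesgue integral over a triple product is finite has that value
as its iterated Bochner integral. -/
theorem integral_integral_integral_eq_of_lintegral_prod {α β γ : Type*} [MeasurableSpace α]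
    [MeasurableSpace β] [MeasurableSpace γ] {μ : Measure α} {ν : Measure β} {ρ : Measure γ}
    [SFinite μ] [SFinite ν] [SFinite ρ] {f : α × β × γ → ℝ} {c : ℝ}
    (hf : AEStronglyMeasurable f (μ.prod (ν.prod ρ))) (h0 : 0 ≤ᵐ[μ.prod (ν.prod ρ)] f) (hc : 0 ≤ c)
    (h : ∫⁻ z, ENNReal.ofReal (f z) ∂(μ.prod (ν.prod ρ)) = ENNReal.ofReal c) :
    ∫ x, ∫ y, ∫ z, f (x, y, z) ∂ρ ∂ν ∂μ = c := by
  have hint : Integrable f (μ.prod (ν.prod ρ)) :=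
    ⟨hf, (hasFiniteIntegral_iff_ofReal h0).2 (h ▸ ENNReal.ofReal_lt_top)⟩
  have hval : ∫ z, f z ∂(μ.prod (ν.prod ρ)) = c := by
    rw [integral_eq_lintegral_of_nonneg_ae h0 hf, h, ENNReal.toReal_ofReal hc]
  rw [← hval, integral_prod _ hint]
  refine integral_congr_ae ?_
  filter_upwards [hint.prod_right_ae] with x hx
  exact (integral_prod _ hx).symm

/-- Differences of negative powers are Laplace transforms. -/
theorem lintegral_rpow_mul_exp_sub_exp {p x y : ℝ} (hp : p < 1) (hx : 0 < x) (hxy : x ≤ y) :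
    ∫⁻ t in Set.Ioi (0:ℝ),
        ENNReal.ofReal (t ^ (-p) * (Real.exp (-(x * t)) - Real.exp (-(y * t))))
      = ENNReal.ofReal (Real.Gamma (1 - p) * (x ^ (p - 1) - y ^ (p - 1))) := by
  have h := lintegral_rpow_mul_exp_neg_mul_sub_Ioi (q := 1 - p) (by linarith) hx hxy
  have hy : 0 < y := hx.trans_le hxy
  rw [show 1 - p - 1 = -p by ring] at h
  rw [h, one_div, one_div, Real.inv_rpow hx.le, Real.inv_rpow hy.le, ← Real.rpow_neg hx.le,
    ← Real.rpow_neg hy.le, neg_sub]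
  congr 1
  ring

/-- The Laplace-side factor of the triple integral after integrating out the space variables. -/
theorem lintegral_prod_exp_factors {p t : ℝ} (hp : 0 < p) (ht : 0 < t) :
    ∫⁻ z : ℝ × ℝ × ℝ, ENNReal.ofReal (z.1 ^ (p - 1) * Real.exp (-(t * z.1))) *
        (ENNReal.ofReal (Real.exp (-((1 + t) * z.2.1))) *
          ENNReal.ofReal (Real.exp (-(2 * z.2.2)) - Real.exp (-((2 * (1 + t)) * z.2.2))))
        ∂((volume.restrict (Set.Ioi 0)).prod
          ((volume.restrict (Set.Ioi 0)).prod (volume.restrict (Set.Ioi 0))))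
      = ENNReal.ofReal
          (Real.Gamma p / 2 * (t ^ (1 - p) * (1 / (1 + t)) ^ 2)) := by
  have hΓ := Real.Gamma_pos_of_pos hp
  have hA := lintegral_rpow_mul_exp_neg_mul_Ioi one_pos (by linarith : 0 < 1 + t)
  have hU := lintegral_rpow_mul_exp_neg_mul_sub_Ioi one_pos two_pos
    (by linarith : (2:ℝ) ≤ 2 * (1 + t))
  simp only [sub_self, Real.rpow_zero, one_mul, Real.rpow_one, Real.Gamma_one, mul_one] at hA hU
  rw [lintegral_prod_mul (f := fun b : ℝ => ENNReal.ofReal (b ^ (p - 1) * Real.exp (-(t * b))))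
      (g := fun y : ℝ × ℝ => ENNReal.ofReal (Real.exp (-((1 + t) * y.1))) *
          ENNReal.ofReal (Real.exp (-(2 * y.2)) - Real.exp (-((2 * (1 + t)) * y.2))))
      (by fun_prop) (by fun_prop),
    lintegral_prod_mul (f := fun a : ℝ => ENNReal.ofReal (Real.exp (-((1 + t) * a))))
      (g := fun u : ℝ => ENNReal.ofReal (Real.exp (-(2 * u)) - Real.exp (-((2 * (1 + t)) * u))))
      (by fun_prop) (by fun_prop),
    lintegral_rpow_mul_exp_neg_mul_Ioi hp ht, hA, hU, ← ENNReal.ofReal_mul (by positivity),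
    ← ENNReal.ofReal_mul (by positivity)]
  congr 1
  rw [one_div t, Real.inv_rpow ht.le, Real.rpow_sub ht, Real.rpow_one]
  field_simp
  ring

theorem L3_evaluation (H : ℝ) (hH : H ∈ Set.Ioo (0:ℝ) (1/2)) :
    2 * ∫ b in Set.Ioi (0:ℝ), ∫ a in Set.Ioi (0:ℝ), ∫ u in Set.Ioi (0:ℝ),
        Real.exp (-(a + 2*u)) * b ^ (2*H - 1) *
          ((a + b) ^ (2*H - 1) - (a + b + 2*u) ^ (2*H - 1))
    = Real.Gamma (2 - 4*H) * Real.Gamma (2*H) * Real.Gamma (4*H) / Real.Gamma (1 - 2*H) := by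
  obtain ⟨hH0, hH1⟩ := hH
  have hp : 0 < 2 * H := by linarith
  have hp1 : 2 * H < 1 := by linarith
  rw [show 4 * H = 2 * (2 * H) by ring]
  generalize 2 * H = p at hp hp1 ⊢
  have hΓp := Real.Gamma_pos_of_pos hp
  have hΓ1 := Real.Gamma_pos_of_pos (by linarith : 0 < 1 - p)
  have hΓ2 := Real.Gamma_pos_of_pos (by linarith : 0 < 2 * p)
  have hΓ3 := Real.Gamma_pos_of_pos (by linarith : 0 < 2 - 2 * p)
  set μ : Measure ℝ := volume.restrict (Set.Ioi 0) with hμ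
  have hmem : ∀ᵐ z ∂(μ.prod (μ.prod μ)), 0 < z.1 ∧ 0 < z.2.1 ∧ 0 < z.2.2 := by
    rw [hμ, Measure.prod_restrict, Measure.prod_restrict]
    filter_upwards [ae_restrict_mem
      (measurableSet_Ioi.prod (measurableSet_Ioi.prod measurableSet_Ioi))] with z hz
    exact ⟨hz.1, hz.2.1, hz.2.2⟩
  have hdiff : ∀ z : ℝ × ℝ × ℝ, 0 < z.1 ∧ 0 < z.2.1 ∧ 0 < z.2.2 →
      0 ≤ (z.2.1 + z.1) ^ (p - 1) - (z.2.1 + z.1 + 2 * z.2.2) ^ (p - 1) := by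
    rintro z ⟨h1, h2, h3⟩
    exact sub_nonneg.2 (Real.rpow_le_rpow_of_nonpos (by linarith) (by linarith) (by linarith))
  have key := integral_integral_integral_eq_of_lintegral_prod (μ := μ) (ν := μ) (ρ := μ)
    (f := fun z : ℝ × ℝ × ℝ => Real.exp (-(z.2.1 + 2 * z.2.2)) * z.1 ^ (p - 1) *
      ((z.2.1 + z.1) ^ (p - 1) - (z.2.1 + z.1 + 2 * z.2.2) ^ (p - 1)))
    (c := 1 / Real.Gamma (1 - p) *
      (Real.Gamma p / 2 * (Real.Gamma (2 - 2 * p) * Real.Gamma (2 * p))))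
    (by
      refine Measurable.aestronglyMeasurable ?_
      fun_prop)
    (by
      filter_upwards [hmem] with z hz
      have := hdiff z hz
      obtain ⟨h1, h2, h3⟩ := hz
      simp only [Pi.zero_apply]
      positivity)
    (by positivity) ?_
  · rw [key]
    field_simp
  have hrep : ∀ᵐ z ∂(μ.prod (μ.prod μ)),
      ENNReal.ofReal (Real.exp (-(z.2.1 + 2 * z.2.2)) * z.1 ^ (p - 1) *
        ((z.2.1 + z.1) ^ (p - 1) - (z.2.1 + z.1 + 2 * z.2.2) ^ (p - 1)))
      = ENNReal.ofReal (1 / Real.Gamma (1 - p)) * ∫⁻ t, ENNReal.ofReal (t ^ (-p)) *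
          (ENNReal.ofReal (z.1 ^ (p - 1) * Real.exp (-(t * z.1))) *
            (ENNReal.ofReal (Real.exp (-((1 + t) * z.2.1))) *
            ENNReal.ofReal (Real.exp (-(2 * z.2.2)) - Real.exp (-((2 * (1 + t)) * z.2.2))))) ∂μ := by
    filter_upwards [hmem] with z hz
    obtain ⟨b, a, u⟩ := z
    obtain ⟨hb, ha, hu⟩ := hz
    dsimp only at hb ha hu ⊢
    have hk : 0 ≤ Real.exp (-(a + 2 * u)) * b ^ (p - 1) := by positivity
    have e : ∀ t ∈ Set.Ioi (0:ℝ), ENNReal.ofReal (t ^ (-p)) *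
          (ENNReal.ofReal (b ^ (p - 1) * Real.exp (-(t * b))) *
            (ENNReal.ofReal (Real.exp (-((1 + t) * a))) *
            ENNReal.ofReal (Real.exp (-(2 * u)) - Real.exp (-((2 * (1 + t)) * u)))))
        = ENNReal.ofReal (Real.exp (-(a + 2 * u)) * b ^ (p - 1)) *
          ENNReal.ofReal (t ^ (-p) *
            (Real.exp (-((a + b) * t)) - Real.exp (-((a + b + 2 * u) * t)))) := by
      intro t ht
      have ht : (0:ℝ) < t := ht
      rw [← ENNReal.ofReal_mul (by positivity), ← ENNReal.ofReal_mul (by positivity),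
        ← ENNReal.ofReal_mul (by positivity), ← ENNReal.ofReal_mul hk]
      congr 1
      rw [show -((1 + t) * a) = -a + -(a * t) by ring,
        show -(2 * (1 + t) * u) = -(2 * u) + -(2 * u * t) by ring,
        show -((a + b) * t) = -(a * t) + -(t * b) by ring,
        show -((a + b + 2 * u) * t) = -(a * t) + -(t * b) + -(2 * u * t) by ring,
        show -(a + 2 * u) = -a + -(2 * u) by ring]
      simp only [Real.exp_add]
      ring
    rw [hμ, setLIntegral_congr_fun measurableSet_Ioi e, lintegral_const_mul _ (by fun_prop),
      lintegral_rpow_mul_exp_sub_exp hp1 (by linarith) (by linarith),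
      ← ENNReal.ofReal_mul hk, ← ENNReal.ofReal_mul (by positivity)]
    congr 1
    field_simp
  have hinner : ∀ t ∈ Set.Ioi (0:ℝ), ∫⁻ z : ℝ × ℝ × ℝ, ENNReal.ofReal (t ^ (-p)) *
          (ENNReal.ofReal (z.1 ^ (p - 1) * Real.exp (-(t * z.1))) *
            (ENNReal.ofReal (Real.exp (-((1 + t) * z.2.1))) *
            ENNReal.ofReal (Real.exp (-(2 * z.2.2)) - Real.exp (-((2 * (1 + t)) * z.2.2)))))
          ∂(μ.prod (μ.prod μ))
      = ENNReal.ofReal (Real.Gamma p / 2) *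
          ENNReal.ofReal (t ^ (1 - 2 * p) * (1 / (1 + t)) ^ 2) := by
    intro t ht
    have ht : (0:ℝ) < t := ht
    rw [lintegral_const_mul _ (by fun_prop), lintegral_prod_exp_factors hp ht,
      ← ENNReal.ofReal_mul (by positivity), ← ENNReal.ofReal_mul (by positivity),
      show 1 - 2 * p = -p + (1 - p) by ring, Real.rpow_add ht]
    congr 1
    ring
  rw [lintegral_congr_ae hrep, lintegral_const_mul' _ _ ENNReal.ofReal_ne_top,
    lintegral_lintegral_swap (by fun_prop), setLIntegral_congr_fun measurableSet_Ioi hinner,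
    lintegral_const_mul _ (by fun_prop),
    lintegral_rpow_div_one_add_sq (by linarith) (by linarith),
    ← ENNReal.ofReal_mul (by positivity), ← ENNReal.ofReal_mul (by positivity)]
end
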